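/- arXiv:2310.20660 — 10 statements merged into one kernel-verified Lean document; each statement's English description precedes it below -/
import Mathlib

section
/- Let 𝔤 and 𝔥 be finite-dimensional real Lie algebras equipped with nondegenerate symmetric bilinear forms g and h, let φ : 𝔥 → Der(𝔤) be a Lie algebra homomorphism, and equip the semidirect product 𝔤̃ = 𝔤 ⋊_φ 𝔥 with the product form g̃(X+A, Y+B) = g(X,Y) + h(A,B). Denote by ∇̃, ∇ᵍ, ∇ʰ the Levi-Civita connections of (𝔤̃, g̃), (𝔤, g), (𝔥, h). Then for all X, Y, Z ∈ 𝔤 and A, B, C ∈ 𝔥: g̃(∇̃_X Y, Z+C) = g(∇ᵍ_X Y, Z) + g(φ(C)^s X, Y); ∇̃_X B = -φ(B)^s X; ∇̃_A B = ∇ʰ_A B; and ∇̃_A Y = φ(A)^a Y. -/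
open Module

/-- Koszul formula computations for the Levi-Civita connection of the
product metric on a semidirect product `𝔤 ⋊_φ 𝔥` (Lemma `tilde_nabla_XY`). -/
theorem stmt_0
    (𝔤 𝔥 G : Type*)
    [LieRing 𝔤] [LieAlgebra ℝ 𝔤] [FiniteDimensional ℝ 𝔤]
    [LieRing 𝔥] [LieAlgebra ℝ 𝔥] [FiniteDimensional ℝ 𝔥]
    [LieRing G] [LieAlgebra ℝ G]
    -- nondegenerate symmetric bilinear forms on 𝔤 and 𝔥
    (g : 𝔤 →ₗ[ℝ] 𝔤 →ₗ[ℝ] ℝ) (h : 𝔥 →ₗ[ℝ] 𝔥 →ₗ[ℝ] ℝ)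
    (gsymm : ∀ x y, g x y = g y x)
    (gnd : ∀ x, (∀ y, g x y = 0) → x = 0)
    (hsymm : ∀ a b, h a b = h b a)
    (hnd : ∀ a, (∀ b, h a b = 0) → a = 0)
    -- φ : 𝔥 → Der(𝔤), a Lie algebra homomorphism into the derivations of 𝔤
    (φ : 𝔥 →ₗ[ℝ] Module.End ℝ 𝔤)
    (hder : ∀ a x y, φ a ⁅x, y⁆ = ⁅φ a x, y⁆ + ⁅x, φ a y⁆)
    (hhom : ∀ a b, φ ⁅a, b⁆ = φ a ∘ₗ φ b - φ b ∘ₗ φ a)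
    -- G is the semidirect product 𝔤 ⋊_φ 𝔥, presented through i, p
    (i : 𝔤 →ₗ[ℝ] G) (p : 𝔥 →ₗ[ℝ] G)
    (hbij : Function.Bijective fun q : 𝔤 × 𝔥 => i q.1 + p q.2)
    (hbrk : ∀ x a y b, ⁅i x + p a, i y + p b⁆
      = i ⁅x, y⁆ + i (φ a y) - i (φ b x) + p ⁅a, b⁆)
    -- the product metric g̃
    (gt : G →ₗ[ℝ] G →ₗ[ℝ] ℝ)
    (hgt : ∀ x a y b, gt (i x + p a) (i y + p b) = g x y + h a b)
    -- Levi-Civita connections via the Koszul formula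
    (lcg : 𝔤 →ₗ[ℝ] 𝔤 →ₗ[ℝ] 𝔤)
    (hlcg : ∀ x y z, 2 * g (lcg x y) z = g ⁅x, y⁆ z - g y ⁅x, z⁆ - g x ⁅y, z⁆)
    (lch : 𝔥 →ₗ[ℝ] 𝔥 →ₗ[ℝ] 𝔥)
    (hlch : ∀ a b c, 2 * h (lch a b) c = h ⁅a, b⁆ c - h b ⁅a, c⁆ - h a ⁅b, c⁆)
    (lct : G →ₗ[ℝ] G →ₗ[ℝ] G)
    (hlct : ∀ u v w, 2 * gt (lct u v) w = gt ⁅u, v⁆ w - gt v ⁅u, w⁆ - gt u ⁅v, w⁆)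
    -- the g-adjoint on endomorphisms of 𝔤
    (adj : Module.End ℝ 𝔤 → Module.End ℝ 𝔤)
    (hadj : ∀ f x y, g (f x) y = g x (adj f y)) :
    (∀ X Y Z C, gt (lct (i X) (i Y)) (i Z + p C)
        = g (lcg X Y) Z + g (((2⁻¹ : ℝ) • (φ C + adj (φ C))) X) Y)
    ∧ (∀ X B, lct (i X) (p B) = - i (((2⁻¹ : ℝ) • (φ B + adj (φ B))) X))
    ∧ (∀ A B, lct (p A) (p B) = p (lch A B))
    ∧ (∀ A Y, lct (p A) (i Y) = i (((2⁻¹ : ℝ) • (φ A - adj (φ A))) Y)) := by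
  have ext : ∀ u v : G, (∀ z c, gt u (i z + p c) = gt v (i z + p c)) → u = v := by
    intro u v huv
    obtain ⟨⟨x, a⟩, hxa⟩ := hbij.2 (u - v)
    have key : ∀ z c, g x z + h a c = 0 := fun z c => by
      rw [← hgt]
      simp only [] at hxa
      rw [hxa, map_sub, LinearMap.sub_apply, huv, sub_self]
    have hx : x = 0 := gnd x fun z => by simpa using key z 0
    have ha : a = 0 := hnd a fun c => by simpa using key 0 c
    rw [← sub_eq_zero, ← hxa]
    simp [hx, ha]
  have koszul : ∀ x a y b z c, 2 * gt (lct (i x + p a) (i y + p b)) (i z + p c)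
      = (g (⁅x, y⁆ + φ a y - φ b x) z + h ⁅a, b⁆ c)
        - (g y (⁅x, z⁆ + φ a z - φ c x) + h b ⁅a, c⁆)
        - (g x (⁅y, z⁆ + φ b z - φ c y) + h a ⁅b, c⁆) := by
    intro x a y b z c
    rw [hlct, hbrk, hbrk, hbrk]
    simp only [← map_add, ← map_sub, hgt]
  have adj_left : ∀ f x y, g (adj f x) y = g x (f y) := fun f x y => by
    rw [gsymm, ← hadj, gsymm]
  refine ⟨fun X Y Z C => ?_, fun X B => ext _ _ fun z c => ?_,
    fun A B => ext _ _ fun z c => ?_, fun A Y => ext _ _ fun z c => ?_⟩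
  · have hk := koszul X 0 Y 0 Z C
    have hg := hlcg X Y Z
    have hs := gsymm Y (φ C X)
    simp [adj_left] at hk ⊢
    linarith
  · have hk := koszul X 0 0 B z c
    have hr := hgt (-(((2⁻¹ : ℝ) • (φ B + adj (φ B))) X)) 0 z c
    rw [map_neg, map_zero, add_zero] at hr
    rw [hr]
    simp [adj_left] at hk ⊢
    linarith
  · have hk := koszul 0 A 0 B z c
    have hr := hgt 0 (lch A B) z c
    rw [map_zero, zero_add] at hr
    rw [hr]
    have hh := hlch A B c
    simp at hk ⊢
    linarith
  · have hk := koszul 0 A Y 0 z c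
    have hr := hgt (((2⁻¹ : ℝ) • (φ A - adj (φ A))) Y) 0 z c
    rw [map_zero, add_zero] at hr
    rw [hr]
    simp [adj_left] at hk ⊢
    linarith
end

section
/- Let (𝔤, g, J_g) and (𝔥, h, J_h) be pseudo-Kähler Lie algebras and let φ : 𝔥 → Der(𝔤) be a Lie algebra homomorphism. Then the semidirect product 𝔤̃ = 𝔤 ⋊_φ 𝔥 with the product structures g̃(X+A, Y+B) = g(X,Y) + h(A,B), J̃(X+A) = J_g X + J_h A is a pseudo-Kähler Lie algebra if and only if, for all A ∈ 𝔥: J_g∘φ(A)^s = φ(J_h A)^s and J_g∘φ(A)^a = φ(A)^a∘J_g. -/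
open Module

/-- A pseudo-Kähler Lie algebra structure: a nondegenerate symmetric bilinear form `g`
and a compatible complex structure `J` which is parallel for the Levi-Civita connection
determined by the Koszul formula. -/
def IsPseudoKahler (L : Type*) [LieRing L] [LieAlgebra ℝ L] [FiniteDimensional ℝ L]
    (g : L →ₗ[ℝ] L →ₗ[ℝ] ℝ) (J : Module.End ℝ L) : Prop :=
  (∀ x y, g x y = g y x) ∧
  (∀ x, (∀ y, g x y = 0) → x = 0) ∧
  (J ∘ₗ J = -1) ∧
  (∀ x y, g (J x) (J y) = g x y) ∧
  ∀ lc : L →ₗ[ℝ] L →ₗ[ℝ] L,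
    (∀ x y z, 2 * g (lc x y) z = g ⁅x, y⁆ z - g y ⁅x, z⁆ - g x ⁅y, z⁆) →
    ∀ x y, lc x (J y) = J (lc x y)

/-- A `g`-orthogonal almost complex structure is `g`-skew. -/
theorem apply_complex_structure_left {V : Type*} [AddCommGroup V] [Module ℝ V]
    {g : V →ₗ[ℝ] V →ₗ[ℝ] ℝ} {J : Module.End ℝ V} (hJ : J ∘ₗ J = -1)
    (hgJ : ∀ x y, g (J x) (J y) = g x y) (x y : V) : g (J x) y = -g x (J y) := by
  have hJJ : J (J x) = -x := LinearMap.congr_fun hJ x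
  rw [← hgJ (J x) y, hJJ, map_neg, LinearMap.neg_apply]

/-- The Koszul expression for `2 g(∇ₓ y, z)`, where `∇` is the Levi-Civita connection of `g`. -/
def koszul {L : Type*} [LieRing L] [LieAlgebra ℝ L] (g : L →ₗ[ℝ] L →ₗ[ℝ] ℝ) (x y z : L) : ℝ :=
  g ⁅x, y⁆ z - g y ⁅x, z⁆ - g x ⁅y, z⁆

/-- A nondegenerate bilinear form on a finite-dimensional Lie algebra has a Levi-Civita
connection. -/
theorem exists_leviCivita {L : Type*} [LieRing L] [LieAlgebra ℝ L] [FiniteDimensional ℝ L]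
    (g : L →ₗ[ℝ] L →ₗ[ℝ] ℝ) (hnd : ∀ x, (∀ y, g x y = 0) → x = 0) :
    ∃ lc : L →ₗ[ℝ] L →ₗ[ℝ] L, ∀ x y z, 2 * g (lc x y) z = koszul g x y z := by
  have hinj : Function.Injective g := by
    refine (injective_iff_map_eq_zero g).2 fun x hx => hnd x fun y => ?_
    rw [hx, LinearMap.zero_apply]
  let e : L ≃ₗ[ℝ] Dual ℝ L :=
    LinearEquiv.ofInjectiveOfFinrankEq g hinj Subspace.dual_finrank_eq.symm
  have he (f : Dual ℝ L) (z : L) : g (e.symm f) z = f z :=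
    LinearMap.congr_fun (e.apply_symm_apply f) z
  let k : L →ₗ[ℝ] L →ₗ[ℝ] Dual ℝ L :=
    LinearMap.mk₂ ℝ
      (fun x y => g ⁅x, y⁆ - g y ∘ₗ (LieAlgebra.ad ℝ L x : Module.End ℝ L)
        - g x ∘ₗ (LieAlgebra.ad ℝ L y : Module.End ℝ L))
      (fun x x' y => by ext z; simp; ring)
      (fun c x y => by ext z; simp; ring)
      (fun x y y' => by ext z; simp; ring)
      (fun c x y => by ext z; simp; ring)
  refine ⟨(2⁻¹ : ℝ) • k.compr₂ e.symm.toLinearMap, fun x y z => ?_⟩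
  simp [he, k, koszul]

/-- For a metric and a compatible almost complex structure, `J` is parallel for the Levi-Civita
connection exactly when it is skew for the last two arguments of the Koszul form. -/
theorem isPseudoKahler_iff_koszul {L : Type*} [LieRing L] [LieAlgebra ℝ L]
    [FiniteDimensional ℝ L] (g : L →ₗ[ℝ] L →ₗ[ℝ] ℝ) (J : Module.End ℝ L) :
    IsPseudoKahler L g J ↔
      (∀ x y, g x y = g y x) ∧ (∀ x, (∀ y, g x y = 0) → x = 0) ∧ (J ∘ₗ J = -1) ∧
      (∀ x y, g (J x) (J y) = g x y) ∧
      ∀ x y z, koszul g x (J y) z + koszul g x y (J z) = 0 := by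
  refine and_congr_right fun _ => and_congr_right fun hnd => and_congr_right fun hJ =>
    and_congr_right fun hgJ => ?_
  have hskew := apply_complex_structure_left hJ hgJ
  constructor
  · intro hlc x y z
    obtain ⟨lc, hk⟩ := exists_leviCivita g hnd
    rw [← hk, ← hk, hlc lc hk, hskew]
    ring
  · intro hK lc hk x y
    refine sub_eq_zero.1 (hnd _ fun z => ?_)
    have h₁ : 2 * g (lc x (J y)) z = koszul g x (J y) z := hk x (J y) z
    have h₂ : 2 * g (lc x y) (J z) = koszul g x y (J z) := hk x y (J z)
    rw [map_sub, LinearMap.sub_apply, hskew]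
    linarith [hK x y z]

/-- Two endomorphisms agree if they have the same pairings for a nondegenerate form. -/
theorem end_ext_iff_of_nondegenerate {V : Type*} [AddCommGroup V] [Module ℝ V]
    {g : V →ₗ[ℝ] V →ₗ[ℝ] ℝ} (hnd : ∀ x, (∀ y, g x y = 0) → x = 0) {f f' : Module.End ℝ V} :
    f = f' ↔ ∀ x y, g (f x) y = g (f' x) y := by
  refine ⟨fun h x y => by rw [h], fun h => LinearMap.ext fun x => ?_⟩
  refine sub_eq_zero.1 (hnd _ fun y => ?_)
  rw [map_sub, LinearMap.sub_apply, h, sub_self]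

/-- the product structures on a semidirect product `𝔤 ⋊_φ 𝔥` of two
pseudo-Kähler Lie algebras are pseudo-Kähler iff `J_g ∘ φ(A)^s = φ(J_h A)^s` and
`J_g ∘ φ(A)^a = φ(A)^a ∘ J_g` for all `A`. -/
theorem stmt_1
    (𝔤 𝔥 G : Type*)
    [LieRing 𝔤] [LieAlgebra ℝ 𝔤] [FiniteDimensional ℝ 𝔤]
    [LieRing 𝔥] [LieAlgebra ℝ 𝔥] [FiniteDimensional ℝ 𝔥]
    [LieRing G] [LieAlgebra ℝ G] [FiniteDimensional ℝ G]
    (g : 𝔤 →ₗ[ℝ] 𝔤 →ₗ[ℝ] ℝ) (Jg : Module.End ℝ 𝔤)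
    (h : 𝔥 →ₗ[ℝ] 𝔥 →ₗ[ℝ] ℝ) (Jh : Module.End ℝ 𝔥)
    (hpkg : IsPseudoKahler 𝔤 g Jg) (hpkh : IsPseudoKahler 𝔥 h Jh)
    -- φ : 𝔥 → Der(𝔤), a Lie algebra homomorphism into the derivations of 𝔤
    (φ : 𝔥 →ₗ[ℝ] Module.End ℝ 𝔤)
    (hder : ∀ a x y, φ a ⁅x, y⁆ = ⁅φ a x, y⁆ + ⁅x, φ a y⁆)
    (hhom : ∀ a b, φ ⁅a, b⁆ = φ a ∘ₗ φ b - φ b ∘ₗ φ a)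
    -- G is the semidirect product 𝔤 ⋊_φ 𝔥, presented through i, p
    (i : 𝔤 →ₗ[ℝ] G) (p : 𝔥 →ₗ[ℝ] G)
    (hbij : Function.Bijective fun q : 𝔤 × 𝔥 => i q.1 + p q.2)
    (hbrk : ∀ x a y b, ⁅i x + p a, i y + p b⁆
      = i ⁅x, y⁆ + i (φ a y) - i (φ b x) + p ⁅a, b⁆)
    -- the product structures g̃ and J̃
    (gt : G →ₗ[ℝ] G →ₗ[ℝ] ℝ)
    (hgt : ∀ x a y b, gt (i x + p a) (i y + p b) = g x y + h a b)
    (Jt : Module.End ℝ G)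
    (hJt : ∀ x a, Jt (i x + p a) = i (Jg x) + p (Jh a))
    -- the g-adjoint on endomorphisms of 𝔤
    (adj : Module.End ℝ 𝔤 → Module.End ℝ 𝔤)
    (hadj : ∀ f x y, g (f x) y = g x (adj f y)) :
    IsPseudoKahler G gt Jt ↔
      ∀ a : 𝔥,
        Jg ∘ₗ ((2⁻¹ : ℝ) • (φ a + adj (φ a))) = (2⁻¹ : ℝ) • (φ (Jh a) + adj (φ (Jh a)))
        ∧ Jg ∘ₗ ((2⁻¹ : ℝ) • (φ a - adj (φ a))) = ((2⁻¹ : ℝ) • (φ a - adj (φ a))) ∘ₗ Jg := by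
  obtain ⟨gsymm, gnd, gJ, ggJ, gK⟩ := (isPseudoKahler_iff_koszul g Jg).1 hpkg
  obtain ⟨hsymm, hnd, hJ, hhJ, hK⟩ := (isPseudoKahler_iff_koszul h Jh).1 hpkh
  have hsurj (u : G) : ∃ x a, u = i x + p a := by
    obtain ⟨q, hq⟩ := hbij.2 u
    exact ⟨q.1, q.2, hq.symm⟩
  have gskew := apply_complex_structure_left gJ ggJ
  have hadj' (f : Module.End ℝ 𝔤) (x y : 𝔤) : g (adj f x) y = g x (f y) := by
    rw [gsymm, ← hadj, gsymm]
  have hkoszul (x y z : 𝔤) (a b c : 𝔥) :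
      koszul gt (i x + p a) (i y + p b) (i z + p c) =
        koszul g x y z + koszul h a b c + (g (φ a y) z - g y (φ a z))
          - (g (φ b x) z + g x (φ b z)) + (g (φ c x) y + g x (φ c y)) := by
    simp only [koszul, hbrk, ← map_add, ← map_sub, hgt]
    simp only [map_add, map_sub, LinearMap.add_apply, LinearMap.sub_apply]
    rw [gsymm y (φ c x)]
    ring
  obtain ⟨gtsymm, gtnd, gtJ, gtgJ⟩ : (∀ u v, gt u v = gt v u) ∧ (∀ u, (∀ v, gt u v = 0) → u = 0) ∧
      Jt ∘ₗ Jt = -1 ∧ ∀ u v, gt (Jt u) (Jt v) = gt u v := by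
    refine ⟨fun u v => ?_, fun u hu => ?_, LinearMap.ext fun u => ?_, fun u v => ?_⟩
    · obtain ⟨x, a, rfl⟩ := hsurj u
      obtain ⟨y, b, rfl⟩ := hsurj v
      rw [hgt, hgt, gsymm, hsymm]
    · obtain ⟨x, a, rfl⟩ := hsurj u
      have hx : x = 0 := gnd x fun y => by simpa [hgt] using (hgt x a y 0).symm.trans (hu _)
      have ha : a = 0 := hnd a fun b => by simpa [hgt] using (hgt x a 0 b).symm.trans (hu _)
      simp [hx, ha]
    · obtain ⟨x, a, rfl⟩ := hsurj u
      have hx : Jg (Jg x) = -x := LinearMap.congr_fun gJ x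
      have ha : Jh (Jh a) = -a := LinearMap.congr_fun hJ a
      simp only [LinearMap.comp_apply, hJt, hx, ha, map_neg, LinearMap.neg_apply,
        Module.End.one_apply, neg_add]
    · obtain ⟨x, a, rfl⟩ := hsurj u
      obtain ⟨y, b, rfl⟩ := hsurj v
      rw [hJt, hJt, hgt, hgt, ggJ, hhJ]
  have hsym (a : 𝔥) :
      Jg ∘ₗ ((2⁻¹ : ℝ) • (φ a + adj (φ a))) = (2⁻¹ : ℝ) • (φ (Jh a) + adj (φ (Jh a))) ↔
        ∀ x z, (g (φ (Jh a) x) z + g x (φ (Jh a) z))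
          + (g (φ a x) (Jg z) + g x (φ a (Jg z))) = 0 := by
    rw [end_ext_iff_of_nondegenerate gnd]
    refine forall₂_congr fun x z => ?_
    simp only [LinearMap.comp_apply, gskew, LinearMap.smul_apply, LinearMap.add_apply, map_smul,
      map_add, hadj', smul_eq_mul]
    constructor <;> intro _ <;> linarith
  have hanti (a : 𝔥) :
      Jg ∘ₗ ((2⁻¹ : ℝ) • (φ a - adj (φ a))) = ((2⁻¹ : ℝ) • (φ a - adj (φ a))) ∘ₗ Jg ↔
        ∀ y z, (g (φ a (Jg y)) z - g (Jg y) (φ a z))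
          + (g (φ a y) (Jg z) - g y (φ a (Jg z))) = 0 := by
    rw [end_ext_iff_of_nondegenerate gnd]
    refine forall₂_congr fun x z => ?_
    rw [LinearMap.comp_apply, gskew]
    simp only [LinearMap.comp_apply, LinearMap.smul_apply, LinearMap.sub_apply, map_smul,
      map_sub, hadj', smul_eq_mul]
    constructor <;> intro _ <;> linarith
  rw [isPseudoKahler_iff_koszul, and_iff_right gtsymm, and_iff_right gtnd, and_iff_right gtJ,
    and_iff_right gtgJ]
  simp only [hsym, hanti]
  constructor
  · intro hKt a
    refine ⟨fun x z => ?_, fun y z => ?_⟩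
    · have hxz := hKt (i x + p 0) (i 0 + p a) (i z + p 0)
      simp only [hJt, hkoszul] at hxz
      simp [koszul] at hxz
      linarith
    · have hyz := hKt (i 0 + p a) (i y + p 0) (i z + p 0)
      simp only [hJt, hkoszul] at hyz
      simp [koszul] at hyz
      linarith
  · intro hφ u v w
    obtain ⟨x, a, rfl⟩ := hsurj u
    obtain ⟨y, b, rfl⟩ := hsurj v
    obtain ⟨z, c, rfl⟩ := hsurj w
    rw [hJt, hJt, hkoszul, hkoszul]
    linarith [gK x y z, hK a b c, (hφ a).2 y z, (hφ b).1 x z, (hφ c).1 x y]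
end

section
/- Let (𝔤, g, J_g) and (𝔥, h, J_h) be pseudo-Kähler Lie algebras and let φ : 𝔥 → Der(𝔤) define a pseudo-Kähler extension 𝔤̃ = 𝔤 ⋊_φ 𝔥 with the product structures (g̃, J̃). Then J̃ is abelian (i.e. [J̃u, J̃v] = [u, v] for all u, v ∈ 𝔤̃) if and only if J_g is abelian, J_h is abelian, and φ(J_h A)^a∘J_g = φ(A)^a for all A ∈ 𝔥. -/
open Module

/-- If `S` and `J ∘ S` are both `g`-self-adjoint and `J` is `g`-orthogonal, then `J ∘ S ∘ J = S`. -/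
theorem comp_comp_eq_self_of_selfAdjoint {V : Type*} [AddCommGroup V] [Module ℝ V]
    (g : V →ₗ[ℝ] V →ₗ[ℝ] ℝ) (hnd : ∀ x, (∀ y, g x y = 0) → x = 0)
    (J S S' : Module.End ℝ V) (hJ : ∀ x y, g (J x) (J y) = g x y)
    (hS : ∀ x y, g (S x) y = g x (S y)) (hS' : ∀ x y, g (S' x) y = g x (S' y))
    (hJS : J ∘ₗ S = S') (x : V) : S' (J x) = S x := by
  refine sub_eq_zero.mp (hnd _ fun y => ?_)
  rw [map_sub, LinearMap.sub_apply, hS', ← hJS, LinearMap.comp_apply, hJ, hS, sub_self]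

/-- `f + f*` is `g`-self-adjoint, up to normalization. -/
theorem selfAdjoint_smul_add_adjoint {V : Type*} [AddCommGroup V] [Module ℝ V]
    (g : V →ₗ[ℝ] V →ₗ[ℝ] ℝ) (hsymm : ∀ x y, g x y = g y x) (f f' : Module.End ℝ V)
    (hf : ∀ x y, g (f x) y = g x (f' y)) (c : ℝ) (x y : V) :
    g ((c • (f + f')) x) y = g x ((c • (f + f')) y) := by
  have hf' : g (f' x) y = g x (f y) := by rw [hsymm, ← hf, hsymm]
  simp [hf, hf', add_comm]

/-- for a pseudo-Kähler extension `𝔤 ⋊_φ 𝔥`, the complex structure `J̃`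
is abelian iff `J_g` and `J_h` are abelian and `φ(J_h A)^a ∘ J_g = φ(A)^a` for all `A`. -/
theorem stmt_3
    (𝔤 𝔥 G : Type*)
    [LieRing 𝔤] [LieAlgebra ℝ 𝔤] [FiniteDimensional ℝ 𝔤]
    [LieRing 𝔥] [LieAlgebra ℝ 𝔥] [FiniteDimensional ℝ 𝔥]
    [LieRing G] [LieAlgebra ℝ G] [FiniteDimensional ℝ G]
    (g : 𝔤 →ₗ[ℝ] 𝔤 →ₗ[ℝ] ℝ) (Jg : Module.End ℝ 𝔤)
    (h : 𝔥 →ₗ[ℝ] 𝔥 →ₗ[ℝ] ℝ) (Jh : Module.End ℝ 𝔥)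
    (hpkg : IsPseudoKahler 𝔤 g Jg) (hpkh : IsPseudoKahler 𝔥 h Jh)
    -- φ : 𝔥 → Der(𝔤), a Lie algebra homomorphism into the derivations of 𝔤
    (φ : 𝔥 →ₗ[ℝ] Module.End ℝ 𝔤)
    (hder : ∀ a x y, φ a ⁅x, y⁆ = ⁅φ a x, y⁆ + ⁅x, φ a y⁆)
    (hhom : ∀ a b, φ ⁅a, b⁆ = φ a ∘ₗ φ b - φ b ∘ₗ φ a)
    -- the g-adjoint on endomorphisms of 𝔤
    (adj : Module.End ℝ 𝔤 → Module.End ℝ 𝔤)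
    (hadj : ∀ f x y, g (f x) y = g x (adj f y))
    -- φ defines a pseudo-Kähler extension
    (hext : ∀ a : 𝔥,
        Jg ∘ₗ ((2⁻¹ : ℝ) • (φ a + adj (φ a))) = (2⁻¹ : ℝ) • (φ (Jh a) + adj (φ (Jh a)))
        ∧ Jg ∘ₗ ((2⁻¹ : ℝ) • (φ a - adj (φ a))) = ((2⁻¹ : ℝ) • (φ a - adj (φ a))) ∘ₗ Jg)
    -- G is the semidirect product 𝔤 ⋊_φ 𝔥, presented through i, p
    (i : 𝔤 →ₗ[ℝ] G) (p : 𝔥 →ₗ[ℝ] G)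
    (hbij : Function.Bijective fun q : 𝔤 × 𝔥 => i q.1 + p q.2)
    (hbrk : ∀ x a y b, ⁅i x + p a, i y + p b⁆
      = i ⁅x, y⁆ + i (φ a y) - i (φ b x) + p ⁅a, b⁆)
    -- the product structures g̃ and J̃
    (gt : G →ₗ[ℝ] G →ₗ[ℝ] ℝ)
    (hgt : ∀ x a y b, gt (i x + p a) (i y + p b) = g x y + h a b)
    (Jt : Module.End ℝ G)
    (hJt : ∀ x a, Jt (i x + p a) = i (Jg x) + p (Jh a)) :
    (∀ u v : G, ⁅Jt u, Jt v⁆ = ⁅u, v⁆) ↔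
      ((∀ x y : 𝔤, ⁅Jg x, Jg y⁆ = ⁅x, y⁆)
        ∧ (∀ a b : 𝔥, ⁅Jh a, Jh b⁆ = ⁅a, b⁆)
        ∧ ∀ a : 𝔥, ((2⁻¹ : ℝ) • (φ (Jh a) - adj (φ (Jh a)))) ∘ₗ Jg
            = (2⁻¹ : ℝ) • (φ a - adj (φ a))) := by
  obtain ⟨hsymm, hnd, -, hJg, -⟩ := hpkg
  have hsym : ∀ a x, ((2⁻¹ : ℝ) • (φ (Jh a) + adj (φ (Jh a)))) (Jg x)
      = ((2⁻¹ : ℝ) • (φ a + adj (φ a))) x := fun a =>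
    comp_comp_eq_self_of_selfAdjoint g hnd Jg _ _ hJg
      (selfAdjoint_smul_add_adjoint g hsymm _ _ (hadj _) _)
      (selfAdjoint_smul_add_adjoint g hsymm _ _ (hadj _) _) (hext a).1
  have hsplit : ∀ f f' : Module.End ℝ 𝔤, ∀ x,
      f x = ((2⁻¹ : ℝ) • (f + f')) x + ((2⁻¹ : ℝ) • (f - f')) x := by
    intro f f' x
    simp only [LinearMap.smul_apply, LinearMap.add_apply, LinearMap.sub_apply]
    module
  have hanti : (∀ a, ((2⁻¹ : ℝ) • (φ (Jh a) - adj (φ (Jh a)))) ∘ₗ Jg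
      = (2⁻¹ : ℝ) • (φ a - adj (φ a))) ↔ ∀ a x, φ (Jh a) (Jg x) = φ a x := by
    refine forall_congr' fun a => LinearMap.ext_iff.trans (forall_congr' fun x => ?_)
    rw [hsplit (φ (Jh a)) (adj (φ (Jh a))), hsplit (φ a) (adj (φ a)) x, hsym, add_right_inj,
      LinearMap.comp_apply]
  rw [hanti]
  constructor
  · intro H
    have key : ∀ x a y b, (⁅Jg x, Jg y⁆ + φ (Jh a) (Jg y) - φ (Jh b) (Jg x), ⁅Jh a, Jh b⁆)
        = (⁅x, y⁆ + φ a y - φ b x, ⁅a, b⁆) := by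
      intro x a y b
      apply hbij.1
      have := H (i x + p a) (i y + p b)
      rw [hJt, hJt, hbrk, hbrk] at this
      simpa only [map_add, map_sub] using this
    refine ⟨fun x y => ?_, fun a b => ?_, fun a y => ?_⟩
    · simpa using congrArg Prod.fst (key x 0 y 0)
    · exact congrArg Prod.snd (key 0 a 0 b)
    · simpa using congrArg Prod.fst (key 0 a y 0)
  · rintro ⟨h₁, h₂, h₃⟩ u v
    obtain ⟨⟨x, a⟩, rfl⟩ := hbij.2 u
    obtain ⟨⟨y, b⟩, rfl⟩ := hbij.2 v
    simp only [hJt, hbrk, h₁, h₂, h₃]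
end

section
/- Let (𝔤, g, J) be a pseudo-Kähler Lie algebra and 𝔥 ⊆ Der(𝔤) an abelian Lie subalgebra of the derivations of 𝔤 such that: (i) f* ∈ 𝔥 for all f ∈ 𝔥, so that 𝔥 = 𝔥₀ ⊕ 𝔥₁ where 𝔥₀ is the set of g-antisymmetric elements of 𝔥 and 𝔥₁ the set of g-symmetric elements; (ii) 𝔥₀ has even dimension; (iii) J∘A ∈ 𝔥₁ for every A ∈ 𝔥₁; (iv) J∘A = A∘J for all A ∈ 𝔥₀. Then there exist a linear map J_h : 𝔥 → 𝔥 with J_h∘J_h = -id and a nondegenerate symmetric bilinear form h on 𝔥 with h(J_h·, J_h·) = h such that 𝔤 ⋊_ι 𝔥 with the product structures g̃, J̃ is a pseudo-Kähler Lie algebra, where ι : 𝔥 → Der(𝔤) is the inclusion. -/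
open Module

section LinearAlgebra

variable {V : Type*} [AddCommGroup V] [Module ℝ V]

theorem exists_complexStructure_of_even_finrank [FiniteDimensional ℝ V]
    (hV : Even (finrank ℝ V)) : ∃ j : Module.End ℝ V, ∀ v, j (j v) = -v := by
  obtain ⟨n, hn⟩ := hV
  have hdim : finrank ℝ V = finrank ℝ ((Fin n → ℝ) × (Fin n → ℝ)) := by simp [hn]
  let e := LinearEquiv.ofFinrankEq V ((Fin n → ℝ) × (Fin n → ℝ)) hdim
  let r : Module.End ℝ ((Fin n → ℝ) × (Fin n → ℝ)) :=
    (-LinearMap.snd ℝ _ _).prod (LinearMap.fst ℝ _ _)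
  have hr : ∀ w, r (r w) = -w := fun w => by ext <;> simp [r]
  exact ⟨e.symm.toLinearMap ∘ₗ r ∘ₗ e.toLinearMap, fun v => by simp [hr]⟩

theorem exists_hermitian_form [FiniteDimensional ℝ V] (j : Module.End ℝ V)
    (hj : ∀ v, j (j v) = -v) :
    ∃ h : V →ₗ[ℝ] V →ₗ[ℝ] ℝ, (∀ a b, h a b = h b a) ∧
      (∀ a, (∀ b, h a b = 0) → a = 0) ∧ ∀ a b, h (j a) (j b) = h a b := by
  let e : V ≃ₗ[ℝ] EuclideanSpace ℝ (Fin (finrank ℝ V)) :=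
    LinearEquiv.ofFinrankEq _ _ (by simp)
  let h₀ : V →ₗ[ℝ] V →ₗ[ℝ] ℝ :=
    (innerₗ (EuclideanSpace ℝ (Fin (finrank ℝ V)))).compl₁₂ e.toLinearMap e.toLinearMap
  have h₀_apply : ∀ a b, h₀ a b = inner ℝ (e a) (e b) := fun a b => rfl
  have h₀_self : ∀ a, 0 ≤ h₀ a a := fun a => by
    rw [h₀_apply]; exact real_inner_self_nonneg
  refine ⟨h₀ + h₀.compl₁₂ j j, fun a b => ?_, fun a ha => ?_, fun a b => ?_⟩
  · simp only [LinearMap.add_apply, LinearMap.compl₁₂_apply, h₀_apply]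
    rw [real_inner_comm, real_inner_comm (e (j b))]
  · have hsum : h₀ a a + h₀ (j a) (j a) = 0 := ha a
    have hzero : inner ℝ (e a) (e a) = 0 := by
      rw [← h₀_apply]; linarith [h₀_self a, h₀_self (j a)]
    simpa using hzero
  · simp only [LinearMap.add_apply, LinearMap.compl₁₂_apply, hj, map_neg, LinearMap.neg_apply]
    ring

/-- A complex structure on the range of a projection extends to the whole space as soon as the
kernel of the projection has even dimension. -/
theorem exists_complexStructure_extending [FiniteDimensional ℝ V] (S K : Module.End ℝ V)
    (hSS : ∀ v, S (S v) = S v) (hSK : ∀ v, S (K v) = K v) (hKS : ∀ v, K (S v) = K v)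
    (hKK : ∀ v, K (K v) = -S v) (hker : Even (finrank ℝ (LinearMap.ker S))) :
    ∃ j : Module.End ℝ V, (∀ v, j (j v) = -v) ∧ ∀ v, S (j v) = K v := by
  obtain ⟨j₀, hj₀⟩ := exists_complexStructure_of_even_finrank hker
  let P : V →ₗ[ℝ] LinearMap.ker S :=
    (1 - S).codRestrict (LinearMap.ker S) fun v => by simp [hSS]
  have hP : ∀ v, (P v : V) = v - S v := fun v => rfl
  have hSj : ∀ w, S (j₀ w : V) = 0 := fun w => (j₀ w).2
  have hKj : ∀ w, K (j₀ w : V) = 0 := fun w => by rw [← hKS, hSj, map_zero]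
  have hPj : ∀ w, P (j₀ w : V) = j₀ w := fun w => by ext; simp [hP, hSj]
  have hPK : ∀ v, P (K v) = 0 := fun v => by ext; simp [hP, hSK]
  refine ⟨K + (LinearMap.ker S).subtype ∘ₗ j₀ ∘ₗ P, fun v => ?_, fun v => ?_⟩
  · simp [hKK, hKj, hPj, hPK, hj₀, hP, neg_add_eq_sub]
  · simp [hSK, hSj]

end LinearAlgebra

/-- On an adjoint-closed space `H` of endomorphisms whose self-adjoint elements are stable under
left composition with `J`, whose anti-self-adjoint elements form an even-dimensional space, there is
a complex structure acting on symmetric parts as left composition with `J`. -/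
theorem exists_complexStructure_symmetricPart {E : Type*} [AddCommGroup E] [Module ℝ E]
    [FiniteDimensional ℝ E] (g : E →ₗ[ℝ] E →ₗ[ℝ] ℝ) (J : Module.End ℝ E)
    (hsymm : ∀ x y, g x y = g y x) (hnd : ∀ x, (∀ y, g x y = 0) → x = 0)
    (hJ : ∀ x, J (J x) = -x)
    (adj : Module.End ℝ E → Module.End ℝ E) (hadj : ∀ f x y, g (f x) y = g x (adj f y))
    (H : Submodule ℝ (Module.End ℝ E)) (hHadj : ∀ f ∈ H, adj f ∈ H)
    (heven : ∀ H0 : Submodule ℝ (Module.End ℝ E),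
      (∀ f, f ∈ H0 ↔ f ∈ H ∧ adj f = -f) → Even (finrank ℝ H0))
    (hHJ : ∀ f ∈ H, adj f = f → (J ∘ₗ f ∈ H ∧ adj (J ∘ₗ f) = J ∘ₗ f)) :
    ∃ Jh : Module.End ℝ H, (∀ a, Jh (Jh a) = -a) ∧
      ∀ a : H, (Jh a : Module.End ℝ E) + adj (Jh a) = J ∘ₗ ((a : Module.End ℝ E) + adj a) := by
  have adj_eq : ∀ f f' : Module.End ℝ E, (∀ x y, g (f x) y = g x (f' y)) → adj f = f' := by
    intro f f' hf
    ext y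
    refine sub_eq_zero.1 (hnd _ fun x => ?_)
    rw [hsymm, map_sub, ← hadj, hf, sub_self]
  have adj_add : ∀ f f', adj (f + f') = adj f + adj f' := fun f f' =>
    adj_eq _ _ fun x y => by simp [hadj]
  have adj_smul : ∀ (c : ℝ) f, adj (c • f) = c • adj f := fun c f =>
    adj_eq _ _ fun x y => by simp [hadj]
  have adj_adj : ∀ f, adj (adj f) = f := fun f =>
    adj_eq _ _ fun x y => by rw [hsymm, ← hadj, hsymm]
  let S : Module.End ℝ H :=
    { toFun := fun a => ⟨(1 / 2 : ℝ) • ((a : Module.End ℝ E) + adj a),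
        H.smul_mem _ (H.add_mem a.2 (hHadj _ a.2))⟩
      map_add' := fun a b => by
        ext1; simp only [Submodule.coe_add, adj_add]; module
      map_smul' := fun c a => by
        ext1; simp only [Submodule.coe_smul, adj_smul, RingHom.id_apply]; module }
  have coe_S : ∀ a : H, (S a : Module.End ℝ E) = (1 / 2 : ℝ) • ((a : Module.End ℝ E) + adj a) :=
    fun a => rfl
  have adj_S : ∀ a : H, adj (S a) = S a := fun a => by
    rw [coe_S, adj_smul, adj_add, adj_adj, add_comm]
  have S_eq : ∀ a : H, adj a = a → S a = a := fun a ha => by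
    ext1; rw [coe_S, ha]; module
  let K : Module.End ℝ H :=
    { toFun := fun a => ⟨J ∘ₗ (S a : Module.End ℝ E), (hHJ _ (S a).2 (adj_S a)).1⟩
      map_add' := fun a b => by ext1; simp [LinearMap.comp_add]
      map_smul' := fun c a => by ext1; simp [LinearMap.comp_smul] }
  have coe_K : ∀ a : H, (K a : Module.End ℝ E) = J ∘ₗ (S a : Module.End ℝ E) := fun a => rfl
  have adj_K : ∀ a : H, adj (K a) = K a := fun a => (hHJ _ (S a).2 (adj_S a)).2
  have hSS : ∀ a, S (S a) = S a := fun a => S_eq _ (adj_S a)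
  have hSK : ∀ a, S (K a) = K a := fun a => S_eq _ (adj_K a)
  have hker : Even (finrank ℝ (LinearMap.ker S)) := by
    rw [← Submodule.finrank_map_subtype_eq H (LinearMap.ker S)]
    refine heven _ fun f => ?_
    have mem_iff : ∀ hf : f ∈ H, S ⟨f, hf⟩ = 0 ↔ adj f = -f := fun hf => by
      rw [← Submodule.coe_eq_zero, coe_S, smul_eq_zero_iff_right (by norm_num),
        add_comm, add_eq_zero_iff_eq_neg]
    constructor
    · rintro ⟨a, ha, rfl⟩
      exact ⟨a.2, (mem_iff a.2).1 ha⟩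
    · rintro ⟨hf, hf'⟩
      exact ⟨⟨f, hf⟩, (mem_iff hf).2 hf', rfl⟩
  obtain ⟨Jh, hJh, hSJ⟩ := exists_complexStructure_extending S K hSS hSK
    (fun a => by ext1; rw [coe_K, hSS, coe_K])
    (fun a => by ext1; rw [coe_K, hSK, coe_K]; ext x; simp [hJ]) hker
  have two_S : ∀ a : H, (a : Module.End ℝ E) + adj a = (2 : ℝ) • (S a : Module.End ℝ E) :=
    fun a => by rw [coe_S]; module
  refine ⟨Jh, hJh, fun a => ?_⟩
  rw [two_S, two_S, hSJ, coe_K, LinearMap.comp_smul]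

/-- a pseudo-Kähler Lie algebra `(𝔤, g, J)` together with an abelian
subalgebra `𝔥 ⊆ Der(𝔤)` closed under the adjoint, with `𝔥₀` of even dimension,
`J ∘ 𝔥₁ ⊆ 𝔥₁` and `J` commuting with `𝔥₀`, gives a pseudo-Kähler structure on
`𝔤 ⋊_ι 𝔥` (Corollary `abelianextension`). -/
theorem stmt_5
    (𝔤 G : Type*)
    [LieRing 𝔤] [LieAlgebra ℝ 𝔤] [FiniteDimensional ℝ 𝔤]
    [LieRing G] [LieAlgebra ℝ G] [FiniteDimensional ℝ G]
    (g : 𝔤 →ₗ[ℝ] 𝔤 →ₗ[ℝ] ℝ) (J : Module.End ℝ 𝔤)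
    (hpk : IsPseudoKahler 𝔤 g J)
    -- the g-adjoint on endomorphisms of 𝔤
    (adj : Module.End ℝ 𝔤 → Module.End ℝ 𝔤)
    (hadj : ∀ f x y, g (f x) y = g x (adj f y))
    -- 𝔥 ⊆ Der(𝔤) an abelian subalgebra
    (H : Submodule ℝ (Module.End ℝ 𝔤))
    (hHder : ∀ f ∈ H, ∀ x y : 𝔤, f ⁅x, y⁆ = ⁅f x, y⁆ + ⁅x, f y⁆)
    (hHab : ∀ f ∈ H, ∀ f' ∈ H, f ∘ₗ f' = f' ∘ₗ f)
    -- (i) H is closed under the g-adjoint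
    (hHadj : ∀ f ∈ H, adj f ∈ H)
    -- (ii) the space 𝔥₀ of g-antisymmetric elements of H has even dimension
    (hH0even : ∀ H0 : Submodule ℝ (Module.End ℝ 𝔤),
      (∀ f, f ∈ H0 ↔ f ∈ H ∧ adj f = -f) → Even (Module.finrank ℝ H0))
    -- (iii) J ∘ A ∈ 𝔥₁ for every A ∈ 𝔥₁
    (hH1J : ∀ f ∈ H, adj f = f → (J ∘ₗ f ∈ H ∧ adj (J ∘ₗ f) = J ∘ₗ f))
    -- (iv) J ∘ A = A ∘ J for every A ∈ 𝔥₀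
    (hH0J : ∀ f ∈ H, adj f = -f → J ∘ₗ f = f ∘ₗ J)
    -- G is the semidirect product 𝔤 ⋊_ι 𝔥, presented through i, p
    -- (the bracket of 𝔥 vanishes since 𝔥 is abelian)
    (i : 𝔤 →ₗ[ℝ] G) (p : ↥H →ₗ[ℝ] G)
    (hbij : Function.Bijective fun q : 𝔤 × ↥H => i q.1 + p q.2)
    (hbrk : ∀ (x y : 𝔤) (a b : ↥H), ⁅i x + p a, i y + p b⁆
      = i ⁅x, y⁆ + i ((a : Module.End ℝ 𝔤) y) - i ((b : Module.End ℝ 𝔤) x)) :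
    ∃ (Jh : Module.End ℝ ↥H) (h : ↥H →ₗ[ℝ] ↥H →ₗ[ℝ] ℝ),
      (Jh ∘ₗ Jh = -1)
      ∧ (∀ a b, h a b = h b a)
      ∧ (∀ a, (∀ b, h a b = 0) → a = 0)
      ∧ (∀ a b, h (Jh a) (Jh b) = h a b)
      ∧ ∀ (gt : G →ₗ[ℝ] G →ₗ[ℝ] ℝ) (Jt : Module.End ℝ G),
          (∀ (x y : 𝔤) (a b : ↥H), gt (i x + p a) (i y + p b) = g x y + h a b) →
          (∀ (x : 𝔤) (a : ↥H), Jt (i x + p a) = i (J x) + p (Jh a)) →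
          IsPseudoKahler G gt Jt := by
  obtain ⟨hsymm, hnd, hJJ, hJg, hpar⟩ := hpk
  have hJ : ∀ x, J (J x) = -x := fun x => by
    simpa using LinearMap.congr_fun hJJ x
  have hJskew : ∀ x y, g (J x) y = -g x (J y) := fun x y => by
    rw [← hJg x (J y), hJ, map_neg, neg_neg]
  obtain ⟨Jh, hJh, hJh_sym⟩ := exists_complexStructure_symmetricPart g J hsymm hnd hJ adj hadj H
    hHadj hH0even hH1J
  obtain ⟨h, hh_symm, hh_nd, hh_J⟩ := exists_hermitian_form Jh hJh
  refine ⟨Jh, h, LinearMap.ext fun a => by simp [hJh], hh_symm, hh_nd, hh_J, ?_⟩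
  intro gt Jt hgt hJt
  have hsurj : ∀ X : G, ∃ (x : 𝔤) (a : H), X = i x + p a := fun X => by
    obtain ⟨q, hq⟩ := hbij.2 X
    exact ⟨q.1, q.2, hq.symm⟩
  have hgt_symm : ∀ X Y, gt X Y = gt Y X := fun X Y => by
    obtain ⟨x, a, rfl⟩ := hsurj X
    obtain ⟨y, b, rfl⟩ := hsurj Y
    rw [hgt, hgt, hsymm, hh_symm]
  have hgt_nd : ∀ X, (∀ Y, gt X Y = 0) → X = 0 := fun X hX => by
    obtain ⟨x, a, rfl⟩ := hsurj X
    have hx : x = 0 := hnd x fun y => by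
      have hy := hgt x y a 0
      rw [hX] at hy
      simpa using hy.symm
    have ha : a = 0 := hh_nd a fun b => by
      have hb := hgt x 0 a b
      rw [hX] at hb
      simpa using hb.symm
    simp [hx, ha]
  have hJt_sq : ∀ X, Jt (Jt X) = -X := fun X => by
    obtain ⟨x, a, rfl⟩ := hsurj X
    rw [hJt, hJt, hJ, hJh, map_neg, map_neg, neg_add]
  have hJt_gt : ∀ X Y, gt (Jt X) (Jt Y) = gt X Y := fun X Y => by
    obtain ⟨x, a, rfl⟩ := hsurj X
    obtain ⟨y, b, rfl⟩ := hsurj Y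
    rw [hJt, hJt, hgt, hgt, hJg, hh_J]
  refine ⟨hgt_symm, hgt_nd, LinearMap.ext fun X => by simp [hJt_sq], hJt_gt, ?_⟩
  intro lc hlc X Y
  have hJt_skew : ∀ X Y, gt (Jt X) Y = -gt X (Jt Y) := fun X Y => by
    rw [← hJt_gt X (Jt Y), hJt_sq, map_neg, neg_neg]
  have hgt_i : ∀ (x y : 𝔤) (a : H), gt (i x + p a) (i y) = g x y := fun x y a => by
    simpa using hgt x y a 0
  have hbrk_i : ∀ x y : 𝔤, ⁅i x, i y⁆ = i ⁅x, y⁆ := fun x y => by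
    simpa using hbrk x y 0 0
  have hgt_ii : ∀ x y : 𝔤, gt (i x) (i y) = g x y := fun x y => by
    simpa using hgt_i x y 0
  let e : (𝔤 × H) ≃ₗ[ℝ] G :=
    LinearEquiv.ofBijective (i.coprod p) hbij
  have he : ∀ X, i (e.symm X).1 + p (e.symm X).2 = X := fun X => e.apply_symm_apply X
  let lc₀ : 𝔤 →ₗ[ℝ] 𝔤 →ₗ[ℝ] 𝔤 :=
    (lc.compl₁₂ i i).compr₂ (LinearMap.fst ℝ 𝔤 H ∘ₗ e.symm.toLinearMap)
  have hlc₀ : ∀ x y z, 2 * g (lc₀ x y) z = g ⁅x, y⁆ z - g y ⁅x, z⁆ - g x ⁅y, z⁆ := by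
    intro x y z
    have key : gt (lc (i x) (i y)) (i z) = g (lc₀ x y) z := by
      conv_lhs => rw [← he (lc (i x) (i y)), hgt_i]
      rfl
    rw [← key, hlc, hbrk_i, hbrk_i, hbrk_i, hgt_ii, hgt_ii, hgt_ii]
  have hadj' : ∀ (f : Module.End ℝ 𝔤) x y, g (adj f x) y = g x (f y) := fun f x y => by
    rw [hsymm, ← hadj, hsymm]
  -- the contributions of the bracket of `𝔤`, of the skew parts and of the symmetric parts
  have bracket_part : ∀ x y z,
      (g ⁅x, J y⁆ z - g (J y) ⁅x, z⁆ - g x ⁅J y, z⁆)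
        + (g ⁅x, y⁆ (J z) - g y ⁅x, J z⁆ - g x ⁅y, J z⁆) = 0 := fun x y z => by
    rw [← hlc₀, ← hlc₀, hpar lc₀ hlc₀, hJskew]
    ring
  have skew_part : ∀ (a : H) (y z : 𝔤),
      (g ((a : Module.End ℝ 𝔤) (J y)) z - g (J y) ((a : Module.End ℝ 𝔤) z))
        + (g ((a : Module.End ℝ 𝔤) y) (J z) - g y ((a : Module.End ℝ 𝔤) (J z))) = 0 := by
    intro a y z
    set f : Module.End ℝ 𝔤 := (a : Module.End ℝ 𝔤) with hf
    have hskew : ∀ x y, g ((f - adj f) x) y = g x ((adj f - f) y) := fun x y => by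
      simp only [LinearMap.sub_apply, map_sub]
      rw [← hadj, hadj']
    have hadj_skew : adj (f - adj f) = -(f - adj f) := by
      ext y
      refine sub_eq_zero.1 (hnd _ fun x => ?_)
      rw [hsymm, map_sub, ← hadj, hskew, neg_sub, sub_self]
    have hcomm := LinearMap.congr_fun
      (hH0J _ (H.sub_mem a.2 (hHadj _ a.2)) hadj_skew) y
    have hcomm_g : g (J (f y - adj f y)) z = g (f (J y) - adj f (J y)) z := by
      simpa using congrArg (fun v => g v z) hcomm
    rw [hJskew] at hcomm_g
    simp only [map_sub, LinearMap.sub_apply, hadj'] at hcomm_g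
    linarith
  have symm_part : ∀ (b : H) (x z : 𝔤),
      g ((Jh b : Module.End ℝ 𝔤) x) z + g x ((Jh b : Module.End ℝ 𝔤) z)
        + g ((b : Module.End ℝ 𝔤) x) (J z) + g x ((b : Module.End ℝ 𝔤) (J z)) = 0 := by
    intro b x z
    have hb := congrArg (fun f : Module.End ℝ 𝔤 => g (f x) z) (hJh_sym b)
    simp only [LinearMap.comp_apply, LinearMap.add_apply, hJskew, map_add, hadj'] at hb
    linarith
  refine sub_eq_zero.1 (hgt_nd _ fun Z => ?_)
  have hsum : 2 * gt (lc X (Jt Y)) Z + 2 * gt (lc X Y) (Jt Z) = 0 := by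
    rw [hlc, hlc]
    obtain ⟨x, a, rfl⟩ := hsurj X
    obtain ⟨y, b, rfl⟩ := hsurj Y
    obtain ⟨z, c, rfl⟩ := hsurj Z
    have hgt_left : ∀ (x y : 𝔤) (b : H), gt (i x) (i y + p b) = g x y := fun x y b => by
      simpa using hgt x y 0 b
    simp only [hJt, hbrk, ← map_add, ← map_sub, hgt_i, hgt_left]
    simp only [map_add, map_sub, LinearMap.add_apply, LinearMap.sub_apply]
    linarith [bracket_part x y z, skew_part a y z, symm_part b x z, symm_part c x y,
      hsymm y ((Jh c : Module.End ℝ 𝔤) x), hsymm (J y) ((c : Module.End ℝ 𝔤) x)]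
  rw [map_sub, LinearMap.sub_apply, hJt_skew]
  linarith
end

section
/- Let (𝔤, g, J) be a pseudo-Kähler Lie algebra and let ℝ² be the 2-dimensional abelian Lie algebra with basis (a₁, a₂), complex structure J_h a₁ = a₂, J_h a₂ = -a₁, and metric h = a¹⊗a¹ + a²⊗a². (i) If A, B₁, B₂ : 𝔤 → 𝔤 are linear maps with A* = A, A∘J = -J∘A, Bᵢ* = -Bᵢ, Bᵢ∘J = J∘Bᵢ (i = 1, 2), A+B₁ ∈ Der(𝔤), J∘A+B₂ ∈ Der(𝔤), [A, B₂] = J∘[A, B₁] and [B₁, B₂] = 2J∘A∘A, then setting φ(a₁) = A+B₁ and φ(a₂) = J∘A+B₂ defines a Lie algebra homomorphism φ : ℝ² → Der(𝔤) such that 𝔤 ⋊_φ ℝ² with the product structures (g̃, J̃) is a pseudo-Kähler Lie algebra. (ii) Conversely, if φ : ℝ² → Der(𝔤) defines a pseudo-Kähler extension of (𝔤, g, J) by (ℝ², h, J_h), then A := φ(a₁)^s, B₁ := φ(a₁)^a, B₂ := φ(a₂)^a satisfy all the conditions in (i), and moreover φ(a₂)^s = J∘A. -/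
open Module

/-- The Euclidean metric `a¹⊗a¹ + a²⊗a²` on the abelian Lie algebra `ℝ²`. -/
noncomputable def h2 : (ℝ × ℝ) →ₗ[ℝ] (ℝ × ℝ) →ₗ[ℝ] ℝ :=
  LinearMap.mk₂ ℝ (fun a b => a.1 * b.1 + a.2 * b.2)
    (fun _ _ _ => by simp; ring) (fun _ _ _ => by simp; ring)
    (fun _ _ _ => by simp; ring) (fun _ _ _ => by simp; ring)

/-- The complex structure on `ℝ²` with `J a₁ = a₂`, `J a₂ = -a₁`. -/
def Jh2 : Module.End ℝ (ℝ × ℝ) :=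
  LinearMap.prod (-LinearMap.snd ℝ ℝ ℝ) (LinearMap.fst ℝ ℝ ℝ)

/-- A metric-preserving almost complex structure is skew-adjoint. -/
theorem apply_complex_left {L : Type*} [AddCommGroup L] [Module ℝ L]
    {g : L →ₗ[ℝ] L →ₗ[ℝ] ℝ} {J : Module.End ℝ L} (hJ : ∀ x, J (J x) = -x)
    (hg : ∀ x y, g (J x) (J y) = g x y) (x y : L) : g (J x) y = -g x (J y) := by
  have h := hg x (J y)
  rw [hJ, map_neg] at h
  linarith

/-- If `J` is parallel for a Levi-Civita product, the Koszul form is anti-invariant under `J`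
in its last two arguments. -/
theorem koszul_complex_add {L : Type*} [LieRing L] [LieAlgebra ℝ L]
    {g : L →ₗ[ℝ] L →ₗ[ℝ] ℝ} {J : Module.End ℝ L}
    (hg : ∀ x y, g (J x) y = -g x (J y)) {lc : L →ₗ[ℝ] L →ₗ[ℝ] L}
    (hlc : ∀ x y z, 2 * g (lc x y) z = koszul g x y z)
    (hpar : ∀ x y, lc x (J y) = J (lc x y)) (x y z : L) :
    koszul g x (J y) z + koszul g x y (J z) = 0 := by
  rw [← hlc, ← hlc, hpar, hg]
  ring

/-- The converse of `koszul_complex_add` for a nondegenerate metric. -/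
theorem parallel_of_koszul_complex_add {L : Type*} [LieRing L] [LieAlgebra ℝ L]
    {g : L →ₗ[ℝ] L →ₗ[ℝ] ℝ} {J : Module.End ℝ L}
    (hnd : ∀ x, (∀ y, g x y = 0) → x = 0)
    (hg : ∀ x y, g (J x) y = -g x (J y)) {lc : L →ₗ[ℝ] L →ₗ[ℝ] L}
    (hlc : ∀ x y z, 2 * g (lc x y) z = koszul g x y z)
    (hK : ∀ x y z, koszul g x (J y) z + koszul g x y (J z) = 0) (x y : L) :
    lc x (J y) = J (lc x y) := by
  refine sub_eq_zero.mp (hnd _ fun z => ?_)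
  have h := hK x y z
  rw [← hlc, ← hlc] at h
  rw [map_sub, LinearMap.sub_apply, hg]
  linarith

/-- Operators on a nondegenerate metric space that are symmetric and skew-symmetric
respectively, with vanishing sum, are both zero. -/
theorem eq_zero_of_symm_add_skew {L : Type*} [AddCommGroup L] [Module ℝ L]
    {g : L →ₗ[ℝ] L →ₗ[ℝ] ℝ} (hnd : ∀ x, (∀ y, g x y = 0) → x = 0) {C D : Module.End ℝ L}
    (hC : ∀ x y, g (C x) y = g x (C y)) (hD : ∀ x y, g (D x) y = -g x (D y))
    (hCD : ∀ x, C x + D x = 0) : C = 0 ∧ D = 0 := by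
  have hDC (x) : D x = -C x := eq_neg_of_add_eq_zero_right (hCD x)
  have hC0 (x) : C x = 0 := hnd _ fun y => by
    have h := hD x y
    rw [hDC, hDC, map_neg, map_neg, LinearMap.neg_apply, ← hC] at h
    linarith
  exact ⟨LinearMap.ext hC0, LinearMap.ext fun x => by simp [hDC, hC0]⟩

/-- The product structures on a semidirect product `𝔤 ⋊ ℝ²` are pseudo-Kähler when `ℝ²` acts by
`A + B₁` and `J ∘ A + B₂` with `A` symmetric and anticommuting with `J`, and the `Bᵢ`
skew-symmetric and commuting with `J`. -/
theorem isPseudoKahler_extension {𝔤 G : Type*} [LieRing 𝔤] [LieAlgebra ℝ 𝔤]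
    [FiniteDimensional ℝ 𝔤] [LieRing G] [LieAlgebra ℝ G] [FiniteDimensional ℝ G]
    {g : 𝔤 →ₗ[ℝ] 𝔤 →ₗ[ℝ] ℝ} {J : Module.End ℝ 𝔤} (hpk : IsPseudoKahler 𝔤 g J)
    {A B₁ B₂ : Module.End ℝ 𝔤}
    (hA : ∀ x y, g (A x) y = g x (A y)) (hAJ : ∀ x, A (J x) = -J (A x))
    (hB₁ : ∀ x y, g (B₁ x) y = -(g x (B₁ y))) (hB₂ : ∀ x y, g (B₂ x) y = -(g x (B₂ y)))
    (hBJ₁ : ∀ x, B₁ (J x) = J (B₁ x)) (hBJ₂ : ∀ x, B₂ (J x) = J (B₂ x))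
    (i : 𝔤 →ₗ[ℝ] G) (p : (ℝ × ℝ) →ₗ[ℝ] G)
    (hip : Function.Bijective fun q : 𝔤 × (ℝ × ℝ) => i q.1 + p q.2)
    (hbr : ∀ (x y : 𝔤) (a b : ℝ × ℝ), ⁅i x + p a, i y + p b⁆
      = i ⁅x, y⁆ + i ((a.1 • (A + B₁) + a.2 • (J ∘ₗ A + B₂)) y)
        - i ((b.1 • (A + B₁) + b.2 • (J ∘ₗ A + B₂)) x) + p ⁅a, b⁆)
    (gt : G →ₗ[ℝ] G →ₗ[ℝ] ℝ) (Jt : Module.End ℝ G)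
    (hgt : ∀ (x y : 𝔤) (a b : ℝ × ℝ), gt (i x + p a) (i y + p b) = g x y + h2 a b)
    (hJt : ∀ (x : 𝔤) (a : ℝ × ℝ), Jt (i x + p a) = i (J x) + p (Jh2 a)) :
    IsPseudoKahler G gt Jt := by
  obtain ⟨hs, hnd, hJ, hgJ, hlc⟩ := hpk
  have hJ' (x) : J (J x) = -x := by simpa using LinearMap.congr_fun hJ x
  have hgJ' := apply_complex_left hJ' hgJ
  have hsurj (u : G) : ∃ x a, u = i x + p a := by
    obtain ⟨⟨x, a⟩, h⟩ := hip.2 u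
    exact ⟨x, a, h.symm⟩
  have hh2 (a b : ℝ × ℝ) : h2 a b = a.1 * b.1 + a.2 * b.2 := rfl
  have hJ1 (a : ℝ × ℝ) : (Jh2 a).1 = -a.2 := rfl
  have hJ2 (a : ℝ × ℝ) : (Jh2 a).2 = a.1 := rfl
  have hab (a b : ℝ × ℝ) : ⁅a, b⁆ = 0 := by
    rw [Ring.lie_def, mul_comm, sub_self]
  have hJJt (u) : Jt (Jt u) = -u := by
    obtain ⟨x, a, rfl⟩ := hsurj u
    have : Jh2 (Jh2 a) = -a := by ext <;> simp [hJ1, hJ2]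
    rw [hJt, hJt, hJ', this, map_neg, map_neg, neg_add]
  have hgJt (u v) : gt (Jt u) (Jt v) = gt u v := by
    obtain ⟨x, a, rfl⟩ := hsurj u
    obtain ⟨y, b, rfl⟩ := hsurj v
    simp only [hJt, hgt, hgJ, hh2, hJ1, hJ2]
    ring
  have hgJt' := apply_complex_left hJJt hgJt
  have hndt (u) (hu : ∀ v, gt u v = 0) : u = 0 := by
    obtain ⟨x, a, rfl⟩ := hsurj u
    have hx : x = 0 := hnd x fun y => by simpa [hh2] using (hgt x y a 0).symm.trans (hu _)
    have ha₁ : a.1 = 0 := by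
      simpa [hh2] using (hgt x 0 a (1, 0)).symm.trans (hu _)
    have ha₂ : a.2 = 0 := by
      simpa [hh2] using (hgt x 0 a (0, 1)).symm.trans (hu _)
    have ha : a = 0 := Prod.ext ha₁ ha₂
    simp [hx, ha]
  have hst (u v) : gt u v = gt v u := by
    obtain ⟨x, a, rfl⟩ := hsurj u
    obtain ⟨y, b, rfl⟩ := hsurj v
    rw [hgt, hgt, hs, hh2, hh2]
    ring
  refine ⟨hst, hndt, LinearMap.ext hJJt, hgJt, fun lc hk => ?_⟩
  -- the tangential part of `lc` is a Levi-Civita product on `𝔤`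
  let e : (𝔤 × (ℝ × ℝ)) ≃ₗ[ℝ] G := LinearEquiv.ofBijective (i.coprod p) hip
  let π : G →ₗ[ℝ] 𝔤 := LinearMap.fst ℝ 𝔤 (ℝ × ℝ) ∘ₗ e.symm.toLinearMap
  have hπ (x a) : π (i x + p a) = x := by
    have : e.symm (i x + p a) = (x, a) := by
      rw [LinearEquiv.symm_apply_eq]
      rfl
    simp [π, this]
  have hgπ (w z) : gt w (i z) = g (π w) z := by
    obtain ⟨x, a, rfl⟩ := hsurj w
    simpa [hπ, hh2] using hgt x z a 0
  have hbr' (x y : 𝔤) : ⁅i x, i y⁆ = i ⁅x, y⁆ := by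
    simpa [hab] using hbr x y 0 0
  have hgi (x y : 𝔤) : gt (i x) (i y) = g x y := by simpa [hh2] using hgt x y 0 0
  have hlcg (x y z) : 2 * g (((lc.compl₁₂ i i).compr₂ π) x y) z = koszul g x y z := by
    have h := hk (i x) (i y) (i z)
    rwa [hgπ, hbr', hbr', hbr', hgi, hgi, hgi] at h
  have hK := koszul_complex_add hgJ' hlcg (hlc _ hlcg)
  refine parallel_of_koszul_complex_add hndt hgJt' hk fun u v w => ?_
  obtain ⟨x, a, rfl⟩ := hsurj u
  obtain ⟨y, b, rfl⟩ := hsurj v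
  obtain ⟨z, c, rfl⟩ := hsurj w
  have hsplit (x y z : 𝔤) (a b c : ℝ × ℝ) :
      koszul gt (i x + p a) (i y + p b) (i z + p c) = koszul g x y z
        + 2 * (a.1 * g (B₁ y) z + a.2 * g (B₂ y) z)
        - 2 * (b.1 * g (A x) z + b.2 * g (J (A x)) z)
        + 2 * (c.1 * g (A x) y + c.2 * g (J (A x)) y) := by
    have hJA (x y) : g x (J (A y)) = g (J (A x)) y := by
      rw [hgJ', hA, hAJ, map_neg, neg_neg]
    have hb₁ (x y) : g x (B₁ y) = -g (B₁ x) y := by rw [hB₁, neg_neg]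
    have hb₂ (x y) : g x (B₂ y) = -g (B₂ x) y := by rw [hB₂, neg_neg]
    have hE (x y z : 𝔤) (a b c : ℝ × ℝ) : gt ⁅i x + p a, i y + p b⁆ (i z + p c)
        = g ⁅x, y⁆ z + (a.1 * (g (A y) z + g (B₁ y) z) + a.2 * (g (J (A y)) z + g (B₂ y) z))
          - (b.1 * (g (A x) z + g (B₁ x) z) + b.2 * (g (J (A x)) z + g (B₂ x) z)) := by
      rw [hbr, hab, ← map_add, ← map_sub, hgt]
      simp
      ring
    simp only [koszul]
    rw [hst (i y + p b), hst (i x + p a) ⁅_, _⁆, hE, hE, hE, hs y, hs x]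
    rw [hs (A z) y, ← hA, hs (B₁ z) y, hb₁, hs (J (A z)) y, hJA, hs (B₂ z) y, hb₂,
      hs (A z) x, ← hA, hs (B₁ z) x, hb₁, hs (J (A z)) x, hJA, hs (B₂ z) x, hb₂,
      hs (A y) x, ← hA, hs (B₁ y) x, hb₁, hs (J (A y)) x, hJA, hs (B₂ y) x, hb₂]
    ring
  rw [hJt, hJt, hsplit, hsplit]
  have h := hK x y z
  simp only [hJ1, hJ2, hBJ₁, hBJ₂, hgJ', hJ', map_neg]
  linear_combination h

/-- pseudo-Kähler extensions of `(𝔤, g, J)` by the standard Euclidean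
`ℝ²` correspond to triples `(A, B₁, B₂)` as in Lemma `AB1B2`. -/
theorem stmt_6
    (𝔤 : Type*) [LieRing 𝔤] [LieAlgebra ℝ 𝔤] [FiniteDimensional ℝ 𝔤]
    (g : 𝔤 →ₗ[ℝ] 𝔤 →ₗ[ℝ] ℝ) (J : Module.End ℝ 𝔤)
    (hpk : IsPseudoKahler 𝔤 g J)
    (adj : Module.End ℝ 𝔤 → Module.End ℝ 𝔤)
    (hadj : ∀ f x y, g (f x) y = g x (adj f y)) :
    -- (i) from a triple (A, B₁, B₂) to a pseudo-Kähler extension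
    (∀ A B₁ B₂ : Module.End ℝ 𝔤,
      (∀ x y, g (A x) y = g x (A y)) →
      (A ∘ₗ J = -(J ∘ₗ A)) →
      (∀ x y, g (B₁ x) y = -(g x (B₁ y))) →
      (∀ x y, g (B₂ x) y = -(g x (B₂ y))) →
      (B₁ ∘ₗ J = J ∘ₗ B₁) → (B₂ ∘ₗ J = J ∘ₗ B₂) →
      (∀ x y : 𝔤, (A + B₁) ⁅x, y⁆ = ⁅(A + B₁) x, y⁆ + ⁅x, (A + B₁) y⁆) →
      (∀ x y : 𝔤, (J ∘ₗ A + B₂) ⁅x, y⁆ = ⁅(J ∘ₗ A + B₂) x, y⁆ + ⁅x, (J ∘ₗ A + B₂) y⁆) →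
      (A ∘ₗ B₂ - B₂ ∘ₗ A = J ∘ₗ (A ∘ₗ B₁ - B₁ ∘ₗ A)) →
      (B₁ ∘ₗ B₂ - B₂ ∘ₗ B₁ = (2 : ℝ) • (J ∘ₗ A ∘ₗ A)) →
      -- φ(a₁) = A + B₁ and φ(a₂) = J∘A + B₂ define a homomorphism ℝ² → Der(𝔤) ...
      ((A + B₁) ∘ₗ (J ∘ₗ A + B₂) = (J ∘ₗ A + B₂) ∘ₗ (A + B₁))
      -- ... and the product structures on 𝔤 ⋊_φ ℝ² are pseudo-Kähler
      ∧ ∀ (G : Type) [LieRing G] [LieAlgebra ℝ G] [FiniteDimensional ℝ G],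
          ∀ (i : 𝔤 →ₗ[ℝ] G) (p : (ℝ × ℝ) →ₗ[ℝ] G),
          (Function.Bijective fun q : 𝔤 × (ℝ × ℝ) => i q.1 + p q.2) →
          (∀ (x y : 𝔤) (a b : ℝ × ℝ), ⁅i x + p a, i y + p b⁆
            = i ⁅x, y⁆ + i ((a.1 • (A + B₁) + a.2 • (J ∘ₗ A + B₂)) y)
              - i ((b.1 • (A + B₁) + b.2 • (J ∘ₗ A + B₂)) x) + p ⁅a, b⁆) →
          ∀ (gt : G →ₗ[ℝ] G →ₗ[ℝ] ℝ) (Jt : Module.End ℝ G),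
            (∀ (x y : 𝔤) (a b : ℝ × ℝ), gt (i x + p a) (i y + p b) = g x y + h2 a b) →
            (∀ (x : 𝔤) (a : ℝ × ℝ), Jt (i x + p a) = i (J x) + p (Jh2 a)) →
            IsPseudoKahler G gt Jt)
    ∧
    -- (ii) conversely, any pseudo-Kähler extension by (ℝ², h2, Jh2) yields such a triple
    (∀ φ : (ℝ × ℝ) →ₗ[ℝ] Module.End ℝ 𝔤,
      (∀ (a : ℝ × ℝ) (x y : 𝔤), φ a ⁅x, y⁆ = ⁅φ a x, y⁆ + ⁅x, φ a y⁆) →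
      (∀ a b : ℝ × ℝ, φ a ∘ₗ φ b = φ b ∘ₗ φ a) →
      (∀ a : ℝ × ℝ,
        J ∘ₗ ((2⁻¹ : ℝ) • (φ a + adj (φ a))) = (2⁻¹ : ℝ) • (φ (Jh2 a) + adj (φ (Jh2 a)))
        ∧ J ∘ₗ ((2⁻¹ : ℝ) • (φ a - adj (φ a))) = ((2⁻¹ : ℝ) • (φ a - adj (φ a))) ∘ₗ J) →
      ∀ A B₁ B₂ : Module.End ℝ 𝔤,
        A = (2⁻¹ : ℝ) • (φ (1, 0) + adj (φ (1, 0))) →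
        B₁ = (2⁻¹ : ℝ) • (φ (1, 0) - adj (φ (1, 0))) →
        B₂ = (2⁻¹ : ℝ) • (φ (0, 1) - adj (φ (0, 1))) →
        ((∀ x y, g (A x) y = g x (A y))
        ∧ (A ∘ₗ J = -(J ∘ₗ A))
        ∧ (∀ x y, g (B₁ x) y = -(g x (B₁ y)))
        ∧ (∀ x y, g (B₂ x) y = -(g x (B₂ y)))
        ∧ (B₁ ∘ₗ J = J ∘ₗ B₁) ∧ (B₂ ∘ₗ J = J ∘ₗ B₂)
        ∧ (∀ x y : 𝔤, (A + B₁) ⁅x, y⁆ = ⁅(A + B₁) x, y⁆ + ⁅x, (A + B₁) y⁆)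
        ∧ (∀ x y : 𝔤, (J ∘ₗ A + B₂) ⁅x, y⁆ = ⁅(J ∘ₗ A + B₂) x, y⁆ + ⁅x, (J ∘ₗ A + B₂) y⁆)
        ∧ (A ∘ₗ B₂ - B₂ ∘ₗ A = J ∘ₗ (A ∘ₗ B₁ - B₁ ∘ₗ A))
        ∧ (B₁ ∘ₗ B₂ - B₂ ∘ₗ B₁ = (2 : ℝ) • (J ∘ₗ A ∘ₗ A))
        ∧ (2⁻¹ : ℝ) • (φ (0, 1) + adj (φ (0, 1))) = J ∘ₗ A)) := by
  obtain ⟨hs, hnd, hJ, hgJ, -⟩ := id hpk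
  have hJ' (x) : J (J x) = -x := by simpa using LinearMap.congr_fun hJ x
  have hgJ' := apply_complex_left hJ' hgJ
  refine ⟨fun A B₁ B₂ hA hAJ hB₁ hB₂ hBJ₁ hBJ₂ _ _ hAB hBB => ⟨?_, ?_⟩, ?_⟩
  · ext x
    have hAJx := LinearMap.congr_fun hAJ (A x)
    have hBJx := LinearMap.congr_fun hBJ₁ (A x)
    have hABx := LinearMap.congr_fun hAB x
    have hBBx := LinearMap.congr_fun hBB x
    simp only [LinearMap.comp_apply, LinearMap.add_apply, LinearMap.sub_apply,
      LinearMap.neg_apply, LinearMap.smul_apply, map_add, map_sub] at *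
    rw [hAJx, hBJx]
    linear_combination (norm := module) hABx + hBBx
  · intro G _ _ _ i p hip hbr gt Jt hgt hJt
    exact isPseudoKahler_extension hpk hA (fun x => LinearMap.congr_fun hAJ x) hB₁ hB₂
      (fun x => LinearMap.congr_fun hBJ₁ x) (fun x => LinearMap.congr_fun hBJ₂ x)
      i p hip hbr gt Jt hgt hJt
  · intro φ hder hcomm hφ A B₁ B₂ hA hB₁ hB₂
    have hadj' (f x y) : g (adj f x) y = g x (f y) := by rw [hs, ← hadj, hs]
    have hadj₂ (f x y) : g x (adj (adj f) y) = g x (f y) := by rw [← hadj, hadj']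
    have hsym (f x y) : g (((2⁻¹ : ℝ) • (f + adj f)) x) y
        = g x (((2⁻¹ : ℝ) • (f + adj f)) y) := by
      simp [hadj, hadj₂, add_comm]
    have hskew (f x y) : g (((2⁻¹ : ℝ) • (f - adj f)) x) y
        = -g x (((2⁻¹ : ℝ) • (f - adj f)) y) := by
      simp only [LinearMap.smul_apply, LinearMap.sub_apply, map_smul, map_sub, hadj, hadj₂,
        smul_eq_mul]
      ring
    have hJ10 : Jh2 (1, 0) = (0, 1) := by simp [Jh2]
    obtain ⟨hJA, hJB₁⟩ := hφ (1, 0)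
    obtain ⟨-, hJB₂⟩ := hφ (0, 1)
    rw [hJ10] at hJA
    have hsA (x y) : g (A x) y = g x (A y) := by rw [hA]; exact hsym _ x y
    have hsJA (x y) : g (J (A x)) y = g x (J (A y)) := by
      have h := hsym (φ (0, 1)) x y
      rwa [← hJA, ← hA] at h
    have hsB₁ (x y) : g (B₁ x) y = -g x (B₁ y) := by rw [hB₁]; exact hskew _ x y
    have hsB₂ (x y) : g (B₂ x) y = -g x (B₂ y) := by rw [hB₂]; exact hskew _ x y
    have hAJ (x) : A (J x) = -J (A x) := by
      refine eq_neg_of_add_eq_zero_left (hnd _ fun y => ?_)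
      rw [map_add, LinearMap.add_apply, hsA, hsJA, hgJ']
      ring
    rw [← hB₁] at hJB₁
    rw [← hB₂] at hJB₂
    rw [← hA] at hJA
    have hJB₁' (x) : B₁ (J x) = J (B₁ x) := (LinearMap.congr_fun hJB₁ x).symm
    have hφ₁ : φ (1, 0) = A + B₁ := by rw [hA, hB₁]; module
    have hφ₂ : φ (0, 1) = J ∘ₗ A + B₂ := by rw [hJA, hB₂]; module
    have hcomm' := hcomm (1, 0) (0, 1)
    have hd₁ := hder (1, 0)
    have hd₂ := hder (0, 1)
    rw [hφ₁, hφ₂] at hcomm'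
    rw [hφ₁] at hd₁
    rw [hφ₂] at hd₂
    have hJB₂' (x) : B₂ (J x) = J (B₂ x) := (LinearMap.congr_fun hJB₂ x).symm
    obtain ⟨hC, hD⟩ := eq_zero_of_symm_add_skew hnd
      (C := (A ∘ₗ B₂ - B₂ ∘ₗ A) - J ∘ₗ (A ∘ₗ B₁ - B₁ ∘ₗ A))
      (D := (B₁ ∘ₗ B₂ - B₂ ∘ₗ B₁) - (2 : ℝ) • (J ∘ₗ A ∘ₗ A))
      (fun x y => by
        simp only [LinearMap.comp_apply, LinearMap.sub_apply, map_sub, hsA, hsB₁, hsB₂, hgJ',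
          hAJ, hJB₁', map_neg]
        ring)
      (fun x y => by
        simp only [LinearMap.comp_apply, LinearMap.sub_apply, LinearMap.smul_apply, map_sub,
          map_smul, smul_eq_mul, hsA, hsB₁, hsB₂, hgJ', hAJ, map_neg]
        ring)
      (fun x => by
        have h := LinearMap.congr_fun hcomm' x
        simp only [LinearMap.comp_apply, LinearMap.sub_apply, LinearMap.smul_apply, map_sub,
          LinearMap.add_apply, map_add, hAJ, hJB₁'] at h ⊢
        linear_combination (norm := module) h)
    exact ⟨hsA, LinearMap.ext hAJ, hsB₁, hsB₂, hJB₁.symm, hJB₂.symm, hd₁, hd₂,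
      sub_eq_zero.mp hC, sub_eq_zero.mp hD, hJA.symm⟩
end

section
/- Let g be a nondegenerate symmetric bilinear form on ℝ⁴ and J : ℝ⁴ → ℝ⁴ linear with J∘J = -id and g(JX, JY) = g(X, Y) for all X, Y. Let A, B₁, B₂ : ℝ⁴ → ℝ⁴ be linear maps with A* = A, A∘J = -J∘A, Bᵢ* = -Bᵢ, Bᵢ∘J = J∘Bᵢ (i = 1, 2), [A, B₂] = J∘[A, B₁] and [B₁, B₂] = 2J∘A∘A. If A is nonzero and semisimple, then there exist a basis (e₁, e₂, e₃, e₄) of ℝ⁴ and real numbers a, k₁, k₂ with k₁² + k₂² = 2a² such that, with respect to this basis, g = e¹⊗e¹ - e²⊗e² + e³⊗e³ - e⁴⊗e⁴, J e₁ = e₃, J e₂ = e₄, and A, B₁, B₂ have matrices (listed row by row) A = [[a,a,0,0],[-a,a,0,0],[0,0,-a,-a],[0,0,a,-a]], B₁ = [[0,k₁,-k₂,0],[k₁,0,0,k₂],[k₂,0,0,k₁],[0,-k₂,k₁,0]], B₂ = [[0,k₂,k₁,0],[k₂,0,0,-k₁],[-k₁,0,0,k₂],[0,k₁,k₂,0]].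 -/
open Module

/-- A traceless endomorphism of a plane squares to a scalar. -/
theorem exists_sq_eq_smul_of_trace_eq_zero {K V : Type*} [Field K] [AddCommGroup V] [Module K V]
    (hV : finrank K V = 2) (T : V →ₗ[K] V) (hT : LinearMap.trace K V T = 0) :
    ∃ d : K, ∀ x, T (T x) = d • x := by
  have : FiniteDimensional K V := FiniteDimensional.of_finrank_eq_succ hV
  let b : Basis (Fin 2) K V := finBasisOfFinrankEq K V hV
  have htr : LinearMap.toMatrix b b T 0 0 + LinearMap.toMatrix b b T 1 1 = 0 := by
    rw [← hT, LinearMap.trace_eq_matrix_trace K b, Matrix.trace_fin_two]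
  set M := LinearMap.toMatrix b b T with hM
  have h : T ∘ₗ T = (M 0 0 ^ 2 + M 0 1 * M 1 0) • LinearMap.id := by
    apply (LinearMap.toMatrix b b).injective
    rw [LinearMap.toMatrix_comp b b b, map_smul, LinearMap.toMatrix_id, ← hM]
    ext i j
    fin_cases i <;> fin_cases j <;> simp [Matrix.mul_apply, Fin.sum_univ_two]
    · ring
    · linear_combination M 0 1 * htr
    · linear_combination M 1 0 * htr
    · linear_combination (M 1 1 - M 0 0) * htr
  exact ⟨_, fun x => congrArg (fun f => f x) h⟩

/-- If a traceless endomorphism of a complex plane squares to `c ^ 2` with `c ≠ 0`, then `c` is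
an eigenvalue. -/
theorem exists_eigenvector_of_sq_eq {V : Type*} [AddCommGroup V] [Module ℂ V]
    (hV : finrank ℂ V = 2) (T : V →ₗ[ℂ] V) (hT : LinearMap.trace ℂ V T = 0) {c : ℂ} (hc : c ≠ 0)
    (hsq : ∀ x, T (T x) = c ^ 2 • x) : ∃ v, v ≠ 0 ∧ T v = c • v := by
  have : FiniteDimensional ℂ V := FiniteDimensional.of_finrank_eq_succ hV
  by_contra! h
  have hx : ∀ x, T x + c • x = 0 := fun x => by
    by_contra h0
    refine h _ h0 ?_
    rw [map_add, hsq, map_smul]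
    module
  have hTc : T = (-c) • LinearMap.id := by
    ext x
    simp [eq_neg_of_add_eq_zero_left (hx x)]
  rw [hTc, map_smul, LinearMap.trace_id, hV] at hT
  simp [hc] at hT

/-- An antilinear map of a complex plane whose square is traceless and not nilpotent has an
eigenvector of its square with eigenvalue in the positive imaginary axis. -/
theorem exists_eigenvector_sq_of_antilinear {V : Type*} [AddCommGroup V] [Module ℂ V]
    (hV : finrank ℂ V = 2) (A : V →ₛₗ[starRingEnd ℂ] V) (B₁ B₂ : V →ₗ[ℂ] V)
    (hB : ∀ x, B₁ (B₂ x) - B₂ (B₁ x) = (2 * Complex.I) • A (A x))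
    (hA : ∃ x, A (A (A (A x))) ≠ 0) :
    ∃ (ν : ℝ) (v : V), 0 < ν ∧ A (A v) = (ν * Complex.I) • v ∧
      LinearIndependent ℂ ![v, A v] := by
  have : FiniteDimensional ℂ V := FiniteDimensional.of_finrank_eq_succ hV
  let T : V →ₗ[ℂ] V := A.comp A
  have hTA : ∀ x, T x = A (A x) := fun _ => rfl
  have hT : LinearMap.trace ℂ V T = 0 := by
    have h : (2 * Complex.I) • T = B₁ * B₂ - B₂ * B₁ := by
      ext x
      simp [hTA, ← hB]
    have h' := congrArg (LinearMap.trace ℂ V) h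
    rw [map_smul, map_sub, LinearMap.trace_mul_comm, sub_self] at h'
    simpa using h'
  obtain ⟨d, hd⟩ := exists_sq_eq_smul_of_trace_eq_zero hV T hT
  obtain ⟨x₀, hx₀⟩ := hA
  have hAx₀ : A x₀ ≠ 0 := fun h => hx₀ (by simp [h])
  have hconj : starRingEnd ℂ d = d := by
    have h : starRingEnd ℂ d • A x₀ = d • A x₀ := by
      rw [← map_smulₛₗ, ← hd, ← hd]
      simp [hTA]
    exact smul_left_injective ℂ hAx₀ h
  obtain ⟨r, rfl⟩ := Complex.conj_eq_iff_real.1 hconj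
  have hr : r ≠ 0 := by
    rintro rfl
    exact hx₀ (by simpa [hTA] using hd x₀)
  rcases lt_or_gt_of_ne hr with hr | hr
  · have hν : 0 < Real.sqrt (-r) := Real.sqrt_pos.2 (by linarith)
    have hν2 : ((Real.sqrt (-r) : ℝ) : ℂ) ^ 2 = -r := by
      rw [← Complex.ofReal_pow, Real.sq_sqrt (by linarith)]; simp
    generalize Real.sqrt (-r) = ν at hν hν2
    have hc : (ν * Complex.I : ℂ) ≠ 0 := by simp [hν.ne']
    obtain ⟨v, hv, hTv⟩ := exists_eigenvector_of_sq_eq hV T hT hc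
      (fun x => by rw [hd, mul_pow, hν2, Complex.I_sq]; simp)
    refine ⟨ν, v, hν, hTv, ?_⟩
    rw [LinearIndependent.pair_iff' hv]
    intro a ha
    have h1 : A (A v) = starRingEnd ℂ a • a • v := by rw [ha, ← map_smulₛₗ, ha]
    rw [show A (A v) = _ from hTv, smul_smul] at h1
    have h2 := smul_left_injective ℂ hv h1
    have h3 := congrArg Complex.im h2
    simp at h3
    nlinarith
  · exfalso
    have hs : 0 < Real.sqrt r := Real.sqrt_pos.2 hr
    have hs2 : ((Real.sqrt r : ℝ) : ℂ) ^ 2 = r := by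
      rw [← Complex.ofReal_pow, Real.sq_sqrt hr.le]
    generalize Real.sqrt r = s at hs hs2
    have hc : (s : ℂ) ≠ 0 := by simp [hs.ne']
    obtain ⟨z, hz, hTz⟩ := exists_eigenvector_of_sq_eq hV T hT hc (fun x => by rw [hd, hs2])
    obtain ⟨y, hy, hTy⟩ := exists_eigenvector_of_sq_eq hV T hT (neg_ne_zero.2 hc)
      (fun x => by rw [hd, neg_sq, hs2])
    by_cases hli : LinearIndependent ℂ ![y, A y]
    · let b := basisOfLinearIndependentOfCardEqFinrank hli (by simp [hV])
      have hTs : T = (-(s : ℂ)) • LinearMap.id := by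
        refine b.ext fun i => ?_
        fin_cases i
        · simpa [b] using hTy
        · simp only [b, coe_basisOfLinearIndependentOfCardEqFinrank]
          change A (A (A y)) = (-(s : ℂ)) • A y
          rw [show A (A y) = _ from hTy, map_smulₛₗ]
          simp
      rw [hTs] at hTz
      have := smul_left_injective ℂ hz hTz
      exact hc (self_eq_neg.1 this.symm)
    · rw [LinearIndependent.pair_iff' hy] at hli
      push Not at hli
      obtain ⟨a, ha⟩ := hli
      have h1 : A (A y) = starRingEnd ℂ a • a • y := by rw [ha, ← map_smulₛₗ, ha]
      rw [show A (A y) = _ from hTy, smul_smul] at h1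
      have h2 := smul_left_injective ℂ hy h1
      have h3 := congrArg Complex.re h2
      simp at h3
      nlinarith [sq_nonneg a.re, sq_nonneg a.im]

/-- Real form of `exists_eigenvector_sq_of_antilinear`, with multiplication by `i` given by a
complex structure `J`. -/
theorem exists_sq_eq_smul_complexStructure {V : Type*} [AddCommGroup V] [Module ℝ V]
    (hV : finrank ℝ V = 4) (J A B₁ B₂ : End ℝ V) (hJ : ∀ x, J (J x) = -x)
    (hAJ : ∀ x, A (J x) = -J (A x)) (hB₁J : ∀ x, B₁ (J x) = J (B₁ x))
    (hB₂J : ∀ x, B₂ (J x) = J (B₂ x))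
    (hB : ∀ x, B₁ (B₂ x) - B₂ (B₁ x) = (2 : ℝ) • J (A (A x)))
    (hA : ∃ x, A (A (A (A x))) ≠ 0) :
    ∃ (ν : ℝ) (v : V), 0 < ν ∧ A (A v) = ν • J v ∧
      ∀ z, ∃ p q r s : ℝ, z = p • v + q • J v + r • A v + s • J (A v) := by
  have hJJ : J * J = -1 := LinearMap.ext hJ
  let _ : Module ℂ V := Module.compHom V (Complex.lift ⟨J, hJJ⟩).toRingHom
  have hsmul : ∀ (c : ℂ) (x : V), c • x = c.re • x + c.im • J x := fun _ _ => rfl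
  have : IsScalarTower ℝ ℂ V := ⟨fun r c x => by
    simp only [hsmul, Complex.real_smul, Complex.re_ofReal_mul, Complex.im_ofReal_mul]
    module⟩
  have hVℂ : finrank ℂ V = 2 := by
    have h := Module.finrank_mul_finrank ℝ ℂ V
    rw [Complex.finrank_real_complex, hV] at h
    omega
  let A' : V →ₛₗ[starRingEnd ℂ] V :=
    { toFun := A, map_add' := map_add A, map_smul' := fun c x => by simp [hsmul, hAJ] }
  let C₁ : V →ₗ[ℂ] V :=
    { toFun := B₁, map_add' := map_add B₁, map_smul' := fun c x => by simp [hsmul, hB₁J] }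
  let C₂ : V →ₗ[ℂ] V :=
    { toFun := B₂, map_add' := map_add B₂, map_smul' := fun c x => by simp [hsmul, hB₂J] }
  obtain ⟨ν, v, hν, hv, hli⟩ := exists_eigenvector_sq_of_antilinear hVℂ A' C₁ C₂
    (fun x => (hB x).trans (by rw [hsmul]; simp; rfl)) hA
  refine ⟨ν, v, hν, ?_, fun z => ?_⟩
  · have h : A (A v) = _ := hv
    simpa [hsmul] using h
  · let b := basisOfLinearIndependentOfCardEqFinrank hli (by simp [hVℂ])
    refine ⟨(b.repr z 0).re, (b.repr z 0).im, (b.repr z 1).re, (b.repr z 1).im, ?_⟩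
    have h := b.sum_repr z
    rw [Fin.sum_univ_two] at h
    simp only [b, coe_basisOfLinearIndependentOfCardEqFinrank, Matrix.cons_val_zero,
      Matrix.cons_val_one, hsmul] at h
    rw [add_assoc]
    exact h.symm

/-- A suitable complex multiple `w` of the eigenvector `v`, normalised against `g`. -/
theorem exists_normalized_eigenvector {V : Type*} [AddCommGroup V] [Module ℝ V]
    (g : V →ₗ[ℝ] V →ₗ[ℝ] ℝ) (gsymm : ∀ x y, g x y = g y x) (gnd : ∀ x, (∀ y, g x y = 0) → x = 0)
    (J A : End ℝ V) (hJ : ∀ x, J (J x) = -x) (hgJ : ∀ x y, g (J x) (J y) = g x y)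
    (hAsym : ∀ x y, g (A x) y = g x (A y)) (hAJ : ∀ x, A (J x) = -J (A x))
    {ν : ℝ} {v : V} (hν : 0 < ν) (hv : A (A v) = ν • J v) (hv0 : v ≠ 0)
    (hspan : ∀ z, ∃ p q r s : ℝ, z = p • v + q • J v + r • A v + s • J (A v)) (t : ℝ) :
    ∃ w, A (A w) = ν • J w ∧ g w w = 0 ∧ g (A w) w = t ∧ g (A w) (J w) = -t := by
  have hgJ' : ∀ x y, g (J x) y = -g x (J y) := fun x y => by
    rw [← hgJ (J x) y, hJ]; simp
  have hself : ∀ x, g x (J x) = 0 := fun x => by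
    have h := hgJ' x x
    rw [gsymm] at h
    linarith
  have hnull : ∀ w, A (A w) = ν • J w → g w w = 0 := fun w hw => by
    have h : g (A (A w)) (J w) = g w (A (A (J w))) := by rw [hAsym, hAsym]
    rw [hAJ, map_neg, hAJ, neg_neg, hw] at h
    simp only [map_smul, LinearMap.smul_apply, hgJ, hJ, map_neg, smul_eq_mul] at h
    nlinarith
  have hvA : g v (A v) = g (A v) v := gsymm _ _
  have hvJA : g v (J (A v)) = - g (A v) (J v) := by rw [gsymm, hgJ']
  obtain ⟨c, hc⟩ : ∃ c : ℂ, c ^ 2 * (⟨g (A v) v, -g (A v) (J v)⟩ : ℂ) = ⟨t, t⟩ := by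
    have hne : (⟨g (A v) v, -g (A v) (J v)⟩ : ℂ) ≠ 0 := fun h0 => by
      have h1 : g (A v) v = 0 := congrArg Complex.re h0
      have h2 : -g (A v) (J v) = 0 := congrArg Complex.im h0
      refine hv0 (gnd v fun z => ?_)
      obtain ⟨p, q, r, s, rfl⟩ := hspan z
      simp [hnull v hv, hself, hvA, hvJA, h1, h2]
    obtain ⟨c, hc⟩ := IsAlgClosed.exists_pow_nat_eq
      ((⟨t, t⟩ : ℂ) / ⟨g (A v) v, -g (A v) (J v)⟩) (n := 2) two_pos
    exact ⟨c, by rw [hc, div_mul_cancel₀ _ hne]⟩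
  have hre := congrArg Complex.re hc
  have him := congrArg Complex.im hc
  simp only [Complex.mul_re, Complex.mul_im, pow_two] at hre him
  have hw : A (A (c.re • v + c.im • J v)) = ν • J (c.re • v + c.im • J v) := by
    simp only [map_add, map_smul, hAJ, map_neg, hv, hJ]
    module
  have hJJA : g (J (A v)) (J v) = g (A v) v := hgJ _ _
  have hJA : g (J (A v)) v = - g (A v) (J v) := hgJ' _ _
  refine ⟨c.re • v + c.im • J v, hw, hnull _ hw, ?_, ?_⟩ <;>
    simp only [map_add, map_smul, hAJ, hJ, map_neg, LinearMap.add_apply, LinearMap.smul_apply,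
      LinearMap.neg_apply, smul_eq_mul, hJJA, hJA]
  · linear_combination hre
  · linear_combination -him

/-- Solution of the structure equations for `B₁`, `B₂` once `g`, `J` and `A` are in normal form. -/
theorem exists_normal_form_of_commutators {a : ℝ} (ha : a ≠ 0) (B₁ B₂ : Matrix (Fin 4) (Fin 4) ℝ)
    (ε : Fin 4 → ℝ) (hε : ε = ![1, -1, 1, -1]) (J A : Matrix (Fin 4) (Fin 4) ℝ)
    (hJ : J = !![0, 0, -1, 0; 0, 0, 0, -1; 1, 0, 0, 0; 0, 1, 0, 0])
    (hA : A = !![a, a, 0, 0; -a, a, 0, 0; 0, 0, -a, -a; 0, 0, a, -a])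
    (hB₁ : ∀ i j, ε i * B₁ i j = -(ε j * B₁ j i)) (hB₂ : ∀ i j, ε i * B₂ i j = -(ε j * B₂ j i))
    (hB₁J : B₁ * J = J * B₁) (hB₂J : B₂ * J = J * B₂)
    (hc1 : A * B₂ - B₂ * A = J * (A * B₁ - B₁ * A))
    (hc2 : B₁ * B₂ - B₂ * B₁ = (2 : ℝ) • (J * (A * A))) :
    ∃ k₁ k₂ : ℝ, k₁ ^ 2 + k₂ ^ 2 = 2 * a ^ 2 ∧
      B₁ = !![0, k₁, -k₂, 0; k₁, 0, 0, k₂; k₂, 0, 0, k₁; 0, -k₂, k₁, 0] ∧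
      B₂ = !![0, k₂, k₁, 0; k₂, 0, 0, -k₁; -k₁, 0, 0, k₂; 0, k₁, k₂, 0] := by
  subst hε hJ
  have form : ∀ B : Matrix (Fin 4) (Fin 4) ℝ,
      (∀ i j, (![1, -1, 1, -1] : Fin 4 → ℝ) i * B i j =
        -((![1, -1, 1, -1] : Fin 4 → ℝ) j * B j i)) →
      B * !![0, 0, -1, 0; 0, 0, 0, -1; 1, 0, 0, 0; 0, 1, 0, 0] =
        !![0, 0, -1, 0; 0, 0, 0, -1; 1, 0, 0, 0; 0, 1, 0, 0] * B →
      ∃ p q r s : ℝ, B = !![0, p, -q, -r; p, 0, r, -s; q, r, 0, p; -r, s, p, 0] := by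
    intro B hB hBJ
    refine ⟨B 1 0, B 2 0, B 2 1, B 3 1, ?_⟩
    have e := fun i j => congrFun (congrFun hBJ i) j
    simp [Fin.forall_fin_succ, Matrix.mul_apply, Fin.sum_univ_succ] at hB e
    ext i j
    fin_cases i <;> fin_cases j <;> simp <;> grind
  obtain ⟨p, q, r, s, rfl⟩ := form B₁ hB₁ hB₁J
  obtain ⟨p', q', r', s', rfl⟩ := form B₂ hB₂ hB₂J
  subst hA
  have e := fun i j => congrFun (congrFun hc1 i) j
  have e' := congrFun (congrFun hc2 1) 2
  simp only [Fin.forall_fin_succ] at e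
  simp [Matrix.mul_apply, Fin.sum_univ_succ] at e e'
  obtain ⟨⟨h₀₀, h₀₁, h₀₂, h₀₃⟩, ⟨-, h₁₁, -, h₁₃⟩, -⟩ := e
  have h₁ : r = 0 := mul_left_cancel₀ ha (by linarith)
  have h₂ : r' = 0 := mul_left_cancel₀ ha (by linarith)
  subst h₁ h₂
  have h₃ : s = -q := mul_left_cancel₀ ha (by linarith)
  have h₄ : s' = p := mul_left_cancel₀ ha (by linarith)
  have h₅ : p' = q := mul_left_cancel₀ ha (by linarith)
  have h₆ : q' = -p := mul_left_cancel₀ ha (by linarith)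
  subst h₃ h₄ h₅ h₆
  exact ⟨s', p', by linarith, by simp, by simp⟩

/-- A basis in which `g`, `J` and `A` are in normal form. -/
theorem exists_basis_of_normalized_eigenvector {V : Type*} [AddCommGroup V] [Module ℝ V]
    (hV : finrank ℝ V = 4)
    (g : V →ₗ[ℝ] V →ₗ[ℝ] ℝ) (gsymm : ∀ x y, g x y = g y x)
    (J A : End ℝ V) (hJ : ∀ x, J (J x) = -x) (hgJ : ∀ x y, g (J x) (J y) = g x y)
    (hAsym : ∀ x y, g (A x) y = g x (A y)) (hAJ : ∀ x, A (J x) = -J (A x))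
    {a : ℝ} {w : V} (ha : a ≠ 0) (hw : A (A w) = (2 * a ^ 2) • J w) (h₁ : g w w = 0)
    (h₂ : g (A w) w = 2 * a) (h₃ : g (A w) (J w) = -(2 * a)) :
    ∃ e : Basis (Fin 4) ℝ V,
      (∀ i j, g (e i) (e j) = !![(1 : ℝ), 0, 0, 0; 0, -1, 0, 0; 0, 0, 1, 0; 0, 0, 0, -1] i j) ∧
      J (e 0) = e 2 ∧ J (e 1) = e 3 ∧
      A (e 0) = a • e 0 - a • e 1 ∧ A (e 1) = a • e 0 + a • e 1 ∧
      A (e 2) = -(a • e 2) + a • e 3 ∧ A (e 3) = -(a • e 2) - a • e 3 := by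
  have hgJ' : ∀ x y, g (J x) y = -g x (J y) := fun x y => by
    rw [← hgJ (J x) y, hJ]; simp
  have hself : ∀ x, g x (J x) = 0 := fun x => by
    have h := hgJ' x x
    rw [gsymm] at h
    linarith
  have h₄ : g w (A w) = 2 * a := by rw [gsymm, h₂]
  have h₅ : g w (J (A w)) = 2 * a := by rw [gsymm, hgJ', h₃, neg_neg]
  have h₆ : g (A w) (A w) = 0 := by rw [hAsym, hw]; simp [hself]
  obtain ⟨b, rfl⟩ : ∃ b, a = b⁻¹ := ⟨a⁻¹, (inv_inv a).symm⟩
  have hb : b ≠ 0 := fun h => ha (by simp [h])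
  let f : Fin 4 → V :=
    ![(1 / 2 : ℝ) • w + (b / 4) • (A w + J (A w)), (-(1 / 2) : ℝ) • J w + (b / 4) • (J (A w) - A w),
      (1 / 2 : ℝ) • J w + (b / 4) • (J (A w) - A w), (1 / 2 : ℝ) • w + (-(b / 4)) • (A w + J (A w))]
  have hg : ∀ i j, g (f i) (f j) =
      !![(1 : ℝ), 0, 0, 0; 0, -1, 0, 0; 0, 0, 1, 0; 0, 0, 0, -1] i j := by
    intro i j
    fin_cases i <;> fin_cases j <;>
      simp [f, hgJ', hJ, hself, h₁, h₂, h₃, h₄, h₅, h₆] <;> field_simp <;> norm_num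
  have hli : LinearIndependent ℝ f := by
    refine LinearMap.linearIndependent_of_isOrthoᵢ (B := g) ?_ ?_
    · rw [LinearMap.isOrthoᵢ_def]
      intro i j hij
      rw [hg]
      fin_cases i <;> fin_cases j <;> simp at hij ⊢
    · intro i
      rw [hg]
      fin_cases i <;> simp
  have : FiniteDimensional ℝ V := FiniteDimensional.of_finrank_eq_succ hV
  let e := basisOfLinearIndependentOfCardEqFinrank hli (by simp [hV])
  have he : ⇑e = f := coe_basisOfLinearIndependentOfCardEqFinrank hli _
  refine ⟨e, by simpa [he] using hg, ?_⟩
  rw [he]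
  refine ⟨?_, ?_, ?_, ?_, ?_, ?_⟩ <;> simp [f, hJ, hAJ, hw] <;> match_scalars <;> field_simp <;>
    norm_num

/-- normal form for the data `(g, J, A, B₁, B₂)` on `ℝ⁴` when `A` is
nonzero and semisimple (Lemma `semisimple`). -/
theorem stmt_7
    (g : (Fin 4 → ℝ) →ₗ[ℝ] (Fin 4 → ℝ) →ₗ[ℝ] ℝ)
    (gsymm : ∀ x y, g x y = g y x)
    (gnd : ∀ x, (∀ y, g x y = 0) → x = 0)
    (J : Module.End ℝ (Fin 4 → ℝ))
    (hJ2 : J ∘ₗ J = -1)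
    (hgJ : ∀ x y, g (J x) (J y) = g x y)
    (A B₁ B₂ : Module.End ℝ (Fin 4 → ℝ))
    -- A is g-symmetric and anticommutes with J
    (hAsym : ∀ x y, g (A x) y = g x (A y))
    (hAJ : A ∘ₗ J = -(J ∘ₗ A))
    -- B₁, B₂ are g-antisymmetric and commute with J
    (hB₁skew : ∀ x y, g (B₁ x) y = -(g x (B₁ y)))
    (hB₂skew : ∀ x y, g (B₂ x) y = -(g x (B₂ y)))
    (hB₁J : B₁ ∘ₗ J = J ∘ₗ B₁)
    (hB₂J : B₂ ∘ₗ J = J ∘ₗ B₂)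
    -- [A, B₂] = J ∘ [A, B₁] and [B₁, B₂] = 2 J ∘ A ∘ A
    (hc1 : A ∘ₗ B₂ - B₂ ∘ₗ A = J ∘ₗ (A ∘ₗ B₁ - B₁ ∘ₗ A))
    (hc2 : B₁ ∘ₗ B₂ - B₂ ∘ₗ B₁ = (2 : ℝ) • (J ∘ₗ A ∘ₗ A))
    -- A nonzero and semisimple
    (hA0 : A ≠ 0)
    (hAss : A.IsSemisimple) :
    ∃ (e : Basis (Fin 4) ℝ (Fin 4 → ℝ)) (a k₁ k₂ : ℝ),
      k₁ ^ 2 + k₂ ^ 2 = 2 * a ^ 2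
      ∧ (∀ i j, g (e i) (e j) = !![(1:ℝ),0,0,0; 0,-1,0,0; 0,0,1,0; 0,0,0,-1] i j)
      ∧ J (e 0) = e 2 ∧ J (e 1) = e 3
      ∧ LinearMap.toMatrix e e A = !![a,a,0,0; -a,a,0,0; 0,0,-a,-a; 0,0,a,-a]
      ∧ LinearMap.toMatrix e e B₁ = !![0,k₁,-k₂,0; k₁,0,0,k₂; k₂,0,0,k₁; 0,-k₂,k₁,0]
      ∧ LinearMap.toMatrix e e B₂ = !![0,k₂,k₁,0; k₂,0,0,-k₁; -k₁,0,0,k₂; 0,k₁,k₂,0] := by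
  have hJ : ∀ x, J (J x) = -x := fun x => by simpa using LinearMap.congr_fun hJ2 x
  have hAJ' : ∀ x, A (J x) = -J (A x) := fun x => by simpa using LinearMap.congr_fun hAJ x
  have hB₁J' : ∀ x, B₁ (J x) = J (B₁ x) := LinearMap.congr_fun hB₁J
  have hB₂J' : ∀ x, B₂ (J x) = J (B₂ x) := LinearMap.congr_fun hB₂J
  have hA4 : ∃ x, A (A (A (A x))) ≠ 0 := by
    by_contra! h
    exact hA0 (End.eq_zero_of_isNilpotent_isSemisimple ⟨4, LinearMap.ext h⟩ hAss)
  obtain ⟨ν, v, hν, hv, hspan⟩ := exists_sq_eq_smul_complexStructure (by simp) J A B₁ B₂ hJ hAJ'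
    hB₁J' hB₂J' (LinearMap.congr_fun hc2) hA4
  have hv0 : v ≠ 0 := by
    rintro rfl
    obtain ⟨x, hx⟩ := hA4
    obtain ⟨p, q, r, s, rfl⟩ := hspan x
    simp at hx
  obtain ⟨a, ha, rfl⟩ : ∃ a : ℝ, a ≠ 0 ∧ 2 * a ^ 2 = ν := by
    refine ⟨Real.sqrt (ν / 2), (Real.sqrt_pos.2 (by linarith)).ne', ?_⟩
    rw [Real.sq_sqrt (by linarith)]
    ring
  obtain ⟨w, hw, h₁, h₂, h₃⟩ := exists_normalized_eigenvector g gsymm gnd J A hJ hgJ hAsym hAJ' hν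
    hv hv0 hspan (2 * a)
  obtain ⟨e, hg, hJ0, hJ1, hA₀, hA₁, hA₂, hA₃⟩ := exists_basis_of_normalized_eigenvector (by simp) g
    gsymm J A hJ hgJ hAsym hAJ' ha hw h₁ h₂ h₃
  have hJM : LinearMap.toMatrix e e J =
      !![0, 0, -1, 0; 0, 0, 0, -1; 1, 0, 0, 0; 0, 1, 0, 0] := by
    have hJ₂ : J (e 2) = -e 0 := by rw [← hJ0, hJ]
    have hJ₃ : J (e 3) = -e 1 := by rw [← hJ1, hJ]
    ext i j
    fin_cases i <;> fin_cases j <;>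
      simp [LinearMap.toMatrix_apply, hJ0, hJ1, hJ₂, hJ₃]
  have hAM : LinearMap.toMatrix e e A =
      !![a, a, 0, 0; -a, a, 0, 0; 0, 0, -a, -a; 0, 0, a, -a] := by
    ext i j
    fin_cases i <;> fin_cases j <;>
      simp [LinearMap.toMatrix_apply, hA₀, hA₁, hA₂, hA₃]
  have hcoord : ∀ (B : End ℝ (Fin 4 → ℝ)) (i j : Fin 4),
      g (B (e j)) (e i) = (![1, -1, 1, -1] : Fin 4 → ℝ) i * LinearMap.toMatrix e e B i j := by
    intro B i j
    rw [LinearMap.toMatrix_apply]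
    conv_lhs => rw [← e.sum_repr (B (e j))]
    simp only [Fin.sum_univ_four, map_add, map_smul, LinearMap.add_apply, LinearMap.smul_apply, hg]
    fin_cases i <;> simp
  have hskew : ∀ B : End ℝ (Fin 4 → ℝ), (∀ x y, g (B x) y = -(g x (B y))) → ∀ i j : Fin 4,
      (![1, -1, 1, -1] : Fin 4 → ℝ) i * LinearMap.toMatrix e e B i j =
        -((![1, -1, 1, -1] : Fin 4 → ℝ) j * LinearMap.toMatrix e e B j i) := by
    intro B hB i j
    rw [← hcoord, ← hcoord, hB, gsymm]
  obtain ⟨k₁, k₂, hk, hB₁M, hB₂M⟩ := exists_normal_form_of_commutators ha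
    (LinearMap.toMatrix e e B₁) (LinearMap.toMatrix e e B₂) _ rfl _ _ hJM hAM
    (hskew B₁ hB₁skew) (hskew B₂ hB₂skew)
    (by simpa only [LinearMap.toMatrix_comp e e e] using congrArg (LinearMap.toMatrix e e) hB₁J)
    (by simpa only [LinearMap.toMatrix_comp e e e] using congrArg (LinearMap.toMatrix e e) hB₂J)
    (by simpa only [LinearMap.toMatrix_comp e e e, map_sub]
      using congrArg (LinearMap.toMatrix e e) hc1)
    (by simpa only [LinearMap.toMatrix_comp e e e, map_sub, map_smul]
      using congrArg (LinearMap.toMatrix e e) hc2)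
  exact ⟨e, a, k₁, k₂, hk, hg, hJ0, hJ1, hAM, hB₁M, hB₂M⟩
end

section
/- Let (𝔤, g, J_g) be a 4-dimensional pseudo-Kähler Lie algebra with g definite (positive definite or negative definite), let (𝔥, h, J_h) be a 2-dimensional abelian pseudo-Kähler Lie algebra, and let φ : 𝔥 → Der(𝔤) define a pseudo-Kähler extension of (𝔤, g, J_g) by (𝔥, h, J_h). Then the extension is trivial, i.e. φ(A)^s = 0 for all A ∈ 𝔥. -/
open Module

/-- For a form whose values on nonzero vectors all have the same strict sign, a symmetric
endomorphism whose square is traceless vanishes. -/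
lemma LinearMap.eq_zero_of_trace_mul_self_eq_zero {V : Type*} [AddCommGroup V] [Module ℝ V]
    [FiniteDimensional ℝ V] (g : V →ₗ[ℝ] V →ₗ[ℝ] ℝ) (hsymm : ∀ x y, g x y = g y x)
    (hdef : (∀ x : V, x ≠ 0 → 0 < g x x) ∨ (∀ x : V, x ≠ 0 → g x x < 0))
    (S : Module.End ℝ V) (hS : ∀ x y, g (S x) y = g x (S y))
    (htr : LinearMap.trace ℝ V (S * S) = 0) : S = 0 := by
  obtain ⟨v, hv⟩ := LinearMap.BilinForm.exists_orthogonal_basis (B := g) ⟨hsymm⟩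
  have hne : ∀ x, x ≠ 0 → g x x ≠ 0 := fun x hx =>
    hdef.elim (fun H => (H x hx).ne') (fun H => (H x hx).ne)
  have hcoord : ∀ x i, v.repr x i = g (v i) x / g (v i) (v i) := by
    intro x i
    rw [eq_div_iff (hne _ (v.ne_zero i))]
    conv_rhs => rw [← v.sum_repr x]
    rw [map_sum, Finset.sum_eq_single i]
    · simp
    · intro j _ hj
      have : g (v i) (v j) = 0 := hv hj.symm
      simp [this]
    · simp
  have hentry : ∀ i, v.repr ((S * S) (v i)) i = g (S (v i)) (S (v i)) / g (v i) (v i) := by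
    intro i
    rw [hcoord, Module.End.mul_apply, ← hS]
  rw [LinearMap.trace_eq_matrix_trace ℝ v, Matrix.trace] at htr
  simp only [Matrix.diag_apply, LinearMap.toMatrix_apply, hentry] at htr
  rw [Finset.sum_eq_zero_iff_of_nonneg] at htr
  · refine v.ext fun i => ?_
    by_contra hi
    exact div_ne_zero (hne _ hi) (hne _ (v.ne_zero i)) (htr i (Finset.mem_univ i))
  · intro i _
    by_cases hi : S (v i) = 0
    · simp [hi]
    · rcases hdef with H | H
      · exact (div_pos (H _ hi) (H _ (v.ne_zero i))).le
      · exact (div_pos_of_neg_of_neg (H _ hi) (H _ (v.ne_zero i))).le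

/-- If `S` anticommutes with a complex structure `J`, while `T` and `T'` commute with it, then
commutativity of `S + T` and `J S + T'` forces `S ^ 2` to be traceless. -/
lemma LinearMap.trace_mul_self_eq_zero_of_commute {V : Type*} [AddCommGroup V] [Module ℝ V]
    (J S T T' : Module.End ℝ V) (hJ : J * J = -1) (hS : J * S = -(S * J))
    (hT : J * T = T * J) (hT' : J * T' = T' * J)
    (hcomm : (S + T) * (J * S + T') = (J * S + T') * (S + T)) :
    LinearMap.trace ℝ V (S * S) = 0 := by
  have hcycle : ∀ X Y, J * Y = Y * J →
      LinearMap.trace ℝ V (J * X * Y) = LinearMap.trace ℝ V (J * Y * X) := fun X Y hY => by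
    rw [hY, mul_assoc Y, LinearMap.trace_mul_comm]
  have hSJS : J * (S * (J * S)) = S * S := by
    calc J * (S * (J * S)) = J * S * (J * S) := by rw [mul_assoc]
      _ = -(S * (J * J) * S) := by nth_rw 1 [hS]; simp only [neg_mul, mul_assoc]
      _ = S * S := by simp [hJ]
  have hJJS : J * (J * S * S) = -(S * S) := by
    rw [mul_assoc J S, ← mul_assoc J J, hJ]
    simp
  have key := congrArg (fun X => LinearMap.trace ℝ V (J * X)) hcomm
  simp only [mul_add, add_mul, map_add, hSJS, hJJS, map_neg] at key
  have h1 := hcycle S T' hT'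
  have h2 := hcycle (J * S) T hT
  have h3 := hcycle T T' hT'
  simp only [mul_assoc] at key h1 h2 h3
  linarith

/-- any pseudo-Kähler extension of a 4-dimensional definite Kähler Lie
algebra by a 2-dimensional abelian pseudo-Kähler Lie algebra is trivial. -/
theorem stmt_8
    (𝔤 𝔥 : Type*)
    [LieRing 𝔤] [LieAlgebra ℝ 𝔤] [FiniteDimensional ℝ 𝔤]
    [LieRing 𝔥] [LieAlgebra ℝ 𝔥] [FiniteDimensional ℝ 𝔥]
    (hdim𝔤 : Module.finrank ℝ 𝔤 = 4)
    (hdim𝔥 : Module.finrank ℝ 𝔥 = 2)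
    (hhab : ∀ a b : 𝔥, ⁅a, b⁆ = 0)
    (g : 𝔤 →ₗ[ℝ] 𝔤 →ₗ[ℝ] ℝ) (Jg : Module.End ℝ 𝔤)
    (h : 𝔥 →ₗ[ℝ] 𝔥 →ₗ[ℝ] ℝ) (Jh : Module.End ℝ 𝔥)
    (hpkg : IsPseudoKahler 𝔤 g Jg) (hpkh : IsPseudoKahler 𝔥 h Jh)
    -- g is definite
    (hdef : (∀ x : 𝔤, x ≠ 0 → 0 < g x x) ∨ (∀ x : 𝔤, x ≠ 0 → g x x < 0))
    -- φ : 𝔥 → Der(𝔤), a Lie algebra homomorphism into the derivations of 𝔤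
    (φ : 𝔥 →ₗ[ℝ] Module.End ℝ 𝔤)
    (hder : ∀ a x y, φ a ⁅x, y⁆ = ⁅φ a x, y⁆ + ⁅x, φ a y⁆)
    (hhom : ∀ a b, φ ⁅a, b⁆ = φ a ∘ₗ φ b - φ b ∘ₗ φ a)
    -- the g-adjoint on endomorphisms of 𝔤
    (adj : Module.End ℝ 𝔤 → Module.End ℝ 𝔤)
    (hadj : ∀ f x y, g (f x) y = g x (adj f y))
    -- φ defines a pseudo-Kähler extension
    (hext : ∀ a : 𝔥,
        Jg ∘ₗ ((2⁻¹ : ℝ) • (φ a + adj (φ a))) = (2⁻¹ : ℝ) • (φ (Jh a) + adj (φ (Jh a)))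
        ∧ Jg ∘ₗ ((2⁻¹ : ℝ) • (φ a - adj (φ a))) = ((2⁻¹ : ℝ) • (φ a - adj (φ a))) ∘ₗ Jg) :
    ∀ a : 𝔥, (2⁻¹ : ℝ) • (φ a + adj (φ a)) = 0 := by
  intro a
  obtain ⟨hsymm, hnondeg, hJ, hJg, -⟩ := hpkg
  have hsa : ∀ (b : 𝔥) (x y : 𝔤), g (((2⁻¹ : ℝ) • (φ b + adj (φ b))) x) y =
      g x (((2⁻¹ : ℝ) • (φ b + adj (φ b))) y) := by
    intro b x y
    have h1 := hadj (φ b) x y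
    have h2 : g (adj (φ b) x) y = g x (φ b y) := by
      rw [hsymm, ← hadj, hsymm]
    simp [h1, h2, add_comm]
  have hskew : ∀ x y, g (Jg x) y = -g x (Jg y) := by
    intro x y
    have hJy : Jg (Jg y) = -y := by simpa using LinearMap.congr_fun hJ y
    rw [← hJg x (Jg y), hJy, map_neg, neg_neg]
  obtain ⟨hs, hT⟩ := hext a
  have hT' := (hext (Jh a)).2
  have hsJ := hsa (Jh a)
  rw [← hs] at hsJ
  have hD : φ a = (2⁻¹ : ℝ) • (φ a + adj (φ a)) + (2⁻¹ : ℝ) • (φ a - adj (φ a)) := by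
    module
  have hE : φ (Jh a) = Jg * ((2⁻¹ : ℝ) • (φ a + adj (φ a))) +
      (2⁻¹ : ℝ) • (φ (Jh a) - adj (φ (Jh a))) := by
    rw [Module.End.mul_eq_comp, hs]
    module
  have hcomm : φ a * φ (Jh a) = φ (Jh a) * φ a := by
    have := hhom a (Jh a)
    rw [hhab, map_zero] at this
    exact (sub_eq_zero.mp this.symm)
  have hSa := hsa a
  generalize (2⁻¹ : ℝ) • (φ a + adj (φ a)) = S at *
  generalize (2⁻¹ : ℝ) • (φ a - adj (φ a)) = T at *
  generalize (2⁻¹ : ℝ) • (φ (Jh a) - adj (φ (Jh a))) = T' at *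
  rw [hD, hE] at hcomm
  have hanti : Jg * S = -(S * Jg) := by
    refine LinearMap.ext fun y => sub_eq_zero.mp (hnondeg _ fun x => ?_)
    have h1 := hsJ x y
    simp only [LinearMap.comp_apply, hskew, hSa] at h1
    rw [hsymm]
    simp only [Module.End.mul_apply, LinearMap.neg_apply, map_sub, map_neg]
    linarith
  exact LinearMap.eq_zero_of_trace_mul_self_eq_zero g hsymm hdef S hSa
    (LinearMap.trace_mul_self_eq_zero_of_commute Jg S T T' hJ hanti hT hT' hcomm)
end

section
/- Let g be a nondegenerate symmetric bilinear form on ℝ⁴ and J : ℝ⁴ → ℝ⁴ linear with J∘J = -id and g(JX, JY) = g(X, Y) for all X, Y. Let A, B₁, B₂ : ℝ⁴ → ℝ⁴ be linear maps with A* = A, A∘J = -J∘A, Bᵢ* = -Bᵢ, Bᵢ∘J = J∘Bᵢ (i = 1, 2), [A, B₂] = J∘[A, B₁] and [B₁, B₂] = 2J∘A∘A. If A is not semisimple, then there exist a basis (e₁, e₂, e₃, e₄) of ℝ⁴, a real number a ≠ 0 and real numbers μ₁, μ₂, ν₁, ν₂ with (ν₁, ν₂) and (μ₁, μ₂) linearly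 dependent in ℝ², such that, with respect to this basis, g = e¹⊗e¹ + e²⊗e² - e³⊗e³ - e⁴⊗e⁴, J e₁ = e₂, J e₃ = e₄, and A, B₁, B₂ have matrices (listed row by row) A = [[a,0,-a,0],[0,-a,0,a],[a,0,-a,0],[0,-a,0,a]], B₁ = [[0,ν₂-μ₁,μ₂,μ₁],[-ν₂+μ₁,0,-μ₁,μ₂],[μ₂,-μ₁,0,ν₂+μ₁],[μ₁,μ₂,-ν₂-μ₁,0]], B₂ = [[0,-μ₂-ν₁,ν₂,ν₁],[μ₂+ν₁,0,-ν₁,ν₂],[ν₂,-ν₁,0,-μ₂+ν₁],[ν₁,ν₂,μ₂-ν₁,0]]. -/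
open Module

section ComplexStructure

variable {V : Type*} [AddCommGroup V] [Module ℝ V]

/-- A vector off a complex line and a nonzero vector on it span a complex plane. -/
theorem linearIndependent_of_notMem_complexLine {J : End ℝ V} (hJ : ∀ x, J (J x) = -x) {x y : V}
    (hx : x ≠ 0) (hy : ∀ s t : ℝ, y ≠ s • x + t • J x) :
    LinearIndependent ℝ ![x, J x, y, J y] := by
  rw [Fintype.linearIndependent_iff]
  intro c hc
  simp only [Fin.sum_univ_four, Matrix.cons_val] at hc
  have hJc := congrArg J hc
  simp only [map_add, map_smul, map_zero, hJ] at hJc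
  have h23 : c 2 ^ 2 + c 3 ^ 2 = 0 := by
    by_contra h
    apply hy (-(c 2 * c 0 + c 3 * c 1) / (c 2 ^ 2 + c 3 ^ 2))
      (-(c 2 * c 1 - c 3 * c 0) / (c 2 ^ 2 + c 3 ^ 2))
    have key : (c 2 ^ 2 + c 3 ^ 2) • y
        = (-(c 2 * c 0 + c 3 * c 1)) • x + (-(c 2 * c 1 - c 3 * c 0)) • J x := by
      linear_combination (norm := module) c 2 • hc - c 3 • hJc
    rw [div_eq_inv_mul, div_eq_inv_mul, mul_smul, mul_smul, ← smul_add, ← key, smul_smul,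
      inv_mul_cancel₀ h, one_smul]
  have h2 : c 2 = 0 := by nlinarith [sq_nonneg (c 2), sq_nonneg (c 3)]
  have h3 : c 3 = 0 := by nlinarith [sq_nonneg (c 2), sq_nonneg (c 3)]
  simp only [h2, h3, zero_smul, add_zero, neg_zero, smul_neg] at hc hJc
  have h01 : c 0 ^ 2 + c 1 ^ 2 = 0 := by
    have key : (c 0 ^ 2 + c 1 ^ 2) • x = 0 := by
      linear_combination (norm := module) c 0 • hc - c 1 • hJc
    exact (smul_eq_zero.mp key).resolve_right hx
  have h0 : c 0 = 0 := by nlinarith [sq_nonneg (c 0), sq_nonneg (c 1)]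
  have h1 : c 1 = 0 := by nlinarith [sq_nonneg (c 0), sq_nonneg (c 1)]
  intro i
  fin_cases i <;> assumption

/-- The basis `x, J x, y, J y` of a space of complex dimension two. -/
theorem exists_basis_complexPlane {J : End ℝ V} (hV : finrank ℝ V = 4) (hJ : ∀ x, J (J x) = -x)
    {x y : V} (hx : x ≠ 0) (hy : ∀ s t : ℝ, y ≠ s • x + t • J x) :
    ∃ b : Basis (Fin 4) ℝ V, b 0 = x ∧ b 1 = J x ∧ b 2 = y ∧ b 3 = J y := by
  let b := basisOfLinearIndependentOfCardEqFinrank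
    (linearIndependent_of_notMem_complexLine hJ hx hy) (by simp [hV])
  have hb : ⇑b = ![x, J x, y, J y] := coe_basisOfLinearIndependentOfCardEqFinrank _ _
  exact ⟨b, by simp [hb], by simp [hb], by simp [hb], by simp [hb]⟩

/-- An antilinear map of a complex plane whose square is traceless is semisimple or squares
to zero. -/
theorem isSemisimple_or_sq_eq_zero {J A : End ℝ V} (hV : finrank ℝ V = 4)
    (hJ : ∀ x, J (J x) = -x) (hAJ : ∀ x, A (J x) = -J (A x))
    (htr : LinearMap.trace ℝ V (A * A) = 0) :
    A.IsSemisimple ∨ ∀ x, A (A x) = 0 := by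
  have : FiniteDimensional ℝ V := FiniteDimensional.of_finrank_pos (by omega)
  by_cases h : ∃ x : V, x ≠ 0 ∧ ∀ s t : ℝ, A x ≠ s • x + t • J x
  · obtain ⟨x, hx, hy⟩ := h
    obtain ⟨b, h0, h1, h2, h3⟩ := exists_basis_complexPlane hV hJ hx hy
    obtain ⟨p, q, r, s, hpq⟩ : ∃ p q r s : ℝ,
        A (A x) = p • x + q • J x + r • A x + s • J (A x) := by
      have hsum := b.sum_repr (A (A x))
      rw [Fin.sum_univ_four, h0, h1, h2, h3] at hsum
      exact ⟨_, _, _, _, hsum.symm⟩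
    have hA : A = Matrix.toLin b b
        !![0, 0, p, q; 0, 0, q, -p; 1, 0, r, s; 0, -1, s, -r] := by
      refine b.ext fun i => ?_
      rw [Matrix.toLin_self, Fin.sum_univ_four, h0, h1, h2, h3]
      fin_cases i <;> simp [h0, h1, h2, h3, hAJ, hpq, hJ]
      module
    have ht : 4 * p + 2 * (r ^ 2 + s ^ 2) = 0 := by
      rw [LinearMap.trace_eq_matrix_trace ℝ b, LinearMap.toMatrix_mul, hA,
        LinearMap.toMatrix_toLin] at htr
      simp [Matrix.trace, Fin.sum_univ_four] at htr
      linarith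
    obtain rfl : p = -(r ^ 2 + s ^ 2) / 2 := by linarith
    by_cases hd : (-(r ^ 2 + s ^ 2) / 2) ^ 2 + q ^ 2 = 0
    · right
      have hq : q = 0 := by nlinarith [sq_nonneg q, sq_nonneg (-(r ^ 2 + s ^ 2) / 2)]
      have hrs : -(r ^ 2 + s ^ 2) / 2 = 0 := by
        nlinarith [sq_nonneg q, sq_nonneg (-(r ^ 2 + s ^ 2) / 2)]
      have hr : r = 0 := by nlinarith [sq_nonneg r, sq_nonneg s]
      have hs : s = 0 := by nlinarith [sq_nonneg r, sq_nonneg s]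
      have hAA : A (A x) = 0 := by simp [hpq, hq, hr, hs]
      have : A * A = 0 := by
        refine b.ext fun i => ?_
        fin_cases i <;> simp [h0, h1, h2, h3, hAJ, hAA]
      exact fun v => LinearMap.congr_fun this v
    · left
      have hA4 : A ^ 4 = algebraMap ℝ (End ℝ V) (-((-(r ^ 2 + s ^ 2) / 2) ^ 2 + q ^ 2)) := by
        refine b.ext fun i => ?_
        fin_cases i <;>
          simp [h0, h1, h2, h3, pow_succ, hAJ, hpq, hJ] <;> module
      refine Module.End.isSemisimple_of_squarefree_aeval_eq_zero
        (Polynomial.separable_X_pow_sub_C _ (by norm_num) (neg_ne_zero.mpr hd)).squarefree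
        (p := Polynomial.X ^ 4 - Polynomial.C (-((-(r ^ 2 + s ^ 2) / 2) ^ 2 + q ^ 2))) ?_
      rw [map_sub, map_pow, Polynomial.aeval_X, Polynomial.aeval_C, hA4, sub_self]
  · right
    push Not at h
    have : Nontrivial V := Module.nontrivial_of_finrank_pos (R := ℝ) (by omega)
    obtain ⟨x, hx⟩ := exists_ne (0 : V)
    obtain ⟨y, hy⟩ : ∃ y : V, ∀ s t : ℝ, y ≠ s • x + t • J x := by
      by_contra! hspan
      have htop : Submodule.span ℝ (Set.range ![x, J x]) = ⊤ := by
        refine Submodule.eq_top_iff'.mpr fun y => ?_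
        obtain ⟨s, t, rfl⟩ := hspan y
        exact (Submodule.mem_span_range_iff_exists_fun ℝ).mpr ⟨![s, t], by simp⟩
      have hle := finrank_range_le_card (R := ℝ) ![x, J x]
      rw [Set.finrank, htop, finrank_top, hV, Fintype.card_fin] at hle
      omega
    have hy0 : y ≠ 0 := by simpa using hy 0 0
    obtain ⟨b, h0, h1, h2, h3⟩ := exists_basis_complexPlane hV hJ hx hy
    obtain ⟨p, q, hp⟩ := h x hx
    obtain ⟨r, s, hr⟩ := h y hy0
    have hA : A = Matrix.toLin b b
        !![p, q, 0, 0; q, -p, 0, 0; 0, 0, r, s; 0, 0, s, -r] := by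
      refine b.ext fun i => ?_
      rw [Matrix.toLin_self, Fin.sum_univ_four, h0, h1, h2, h3]
      fin_cases i <;> simp [h0, h1, h2, h3, hAJ, hp, hr, hJ]
    have ht : 2 * (p ^ 2 + q ^ 2) + 2 * (r ^ 2 + s ^ 2) = 0 := by
      rw [LinearMap.trace_eq_matrix_trace ℝ b, LinearMap.toMatrix_mul, hA,
        LinearMap.toMatrix_toLin] at htr
      simp [Matrix.trace, Fin.sum_univ_four] at htr
      linarith
    have hsq : p = 0 ∧ q = 0 ∧ r = 0 ∧ s = 0 := by
      refine ⟨?_, ?_, ?_, ?_⟩ <;>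
        nlinarith [sq_nonneg p, sq_nonneg q, sq_nonneg r, sq_nonneg s]
    obtain ⟨rfl, rfl, rfl, rfl⟩ := hsq
    have : A = 0 := by
      refine b.ext fun i => ?_
      fin_cases i <;> simp [h0, h1, h2, h3, hAJ, hp, hr]
    simp [this]

section Hermitian

variable {g : V →ₗ[ℝ] V →ₗ[ℝ] ℝ} {J A : End ℝ V}

/-- A complex structure preserving `g` is skew with respect to `g`. -/
theorem apply_complexStructure_left (hJ : ∀ x, J (J x) = -x)
    (hgJ : ∀ x y, g (J x) (J y) = g x y) (x y : V) : g (J x) y = -g x (J y) := by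
  rw [← hgJ x (J y), hJ, map_neg, neg_neg]

/-- A nonzero symmetric antilinear map `A` has a vector `x` at which the complex form
`g (A x) x + i g (A x) (J x)` is real and nonzero. -/
theorem exists_apply_ne_zero_of_antilinear (gsymm : ∀ x y, g x y = g y x)
    (gnd : ∀ x, (∀ y, g x y = 0) → x = 0) (hJ : ∀ x, J (J x) = -x)
    (hgJ : ∀ x y, g (J x) (J y) = g x y) (hAsym : ∀ x y, g (A x) y = g x (A y))
    (hAJ : ∀ x, A (J x) = -J (A x)) (hA0 : A ≠ 0) :
    ∃ x, g (A x) x ≠ 0 ∧ g (A x) (J x) = 0 := by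
  have hq : ∀ x y, g (A x) y = g (A y) x := fun x y => by rw [hAsym, gsymm]
  obtain ⟨x, hx⟩ : ∃ x, g (A x) x ≠ 0 := by
    by_contra! h
    refine hA0 (LinearMap.ext fun x => gnd _ fun y => ?_)
    have hxy := h (x + y)
    simp only [map_add, LinearMap.add_apply, h] at hxy
    linarith [hq x y]
  set k := g (A x) x with hk
  set l := g (A x) (J x) with hl
  obtain ⟨t, ht⟩ : ∃ t : ℝ, l * t ^ 2 + 2 * k * t - l = 0 := by
    by_cases hl0 : l = 0
    · exact ⟨0, by simp [hl0]⟩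
    · refine ⟨(-k + √(k ^ 2 + l ^ 2)) / l, ?_⟩
      have hs := Real.sq_sqrt (show 0 ≤ k ^ 2 + l ^ 2 by positivity)
      field_simp
      linear_combination hs
  have hlJ : g (J (A x)) x = -l := apply_complexStructure_left hJ hgJ _ _
  refine ⟨x + t • J x, ?_, ?_⟩
  · have hval : g (A (x + t • J x)) (x + t • J x) = k * (1 - t ^ 2) + 2 * t * l := by
      simp [hAJ, hgJ, hlJ, ← hk, ← hl]
      ring
    rw [hval]
    intro h0
    have h1 : (1 + t ^ 2) ^ 2 * (k ^ 2 + l ^ 2) = 0 := by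
      linear_combination (k * (1 - t ^ 2) + 2 * t * l) * h0 + (l * t ^ 2 + 2 * k * t - l) * ht
    have : 0 < (1 + t ^ 2) ^ 2 * (k ^ 2 + l ^ 2) := by positivity
    exact this.ne' h1
  · simp [hAJ, hgJ, hlJ, hJ, ← hk, ← hl]
    linear_combination -ht

/-- A nonzero symmetric antilinear map of square zero is, in a suitable pair of orthonormal
vectors of opposite sign, a multiple of the standard one. -/
theorem exists_adapted_pair (gsymm : ∀ x y, g x y = g y x)
    (gnd : ∀ x, (∀ y, g x y = 0) → x = 0) (hJ : ∀ x, J (J x) = -x)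
    (hgJ : ∀ x y, g (J x) (J y) = g x y) (hAsym : ∀ x y, g (A x) y = g x (A y))
    (hAJ : ∀ x, A (J x) = -J (A x)) (hA0 : A ≠ 0) (hAA : ∀ x, A (A x) = 0) :
    ∃ (u v : V) (a : ℝ), a ≠ 0 ∧ g u u = 1 ∧ g v v = -1 ∧ g u v = 0 ∧ g u (J v) = 0 ∧
      A u = a • (u + v) ∧ A v = -a • (u + v) := by
  obtain ⟨x, hk, hl⟩ := exists_apply_ne_zero_of_antilinear gsymm gnd hJ hgJ hAsym hAJ hA0
  have hJskew := apply_complexStructure_left (g := g) hJ hgJ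
  have hJself : ∀ y, g y (J y) = 0 := fun y => by linarith [hJskew y y, gsymm y (J y)]
  set k := g (A x) x with hk'
  obtain ⟨n, hn⟩ : ∃ n, n = (2 / k) • A x := ⟨_, rfl⟩
  obtain ⟨m, hm⟩ : ∃ m, m = x - (g x x / 4) • n := ⟨_, rfl⟩
  have hnn : g n n = 0 := by simp [hn, hAsym, hAA]
  have hnx : g n x = 2 := by simp [hn, ← hk', hk]
  have hnJx : g n (J x) = 0 := by simp [hn, hl]
  have hnm : g n m = 2 := by simp [hm, hnn, hnx]
  have hnJm : g n (J m) = 0 := by simp [hm, hnJx, hJself]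
  have hmn : g m n = 2 := by rw [gsymm, hnm]
  have hmJn : g m (J n) = 0 := by rw [gsymm, hJskew, hnJm, neg_zero]
  have hmm : g m m = 0 := by
    have hxn : g x n = 2 := by rw [gsymm, hnx]
    simp [hm, hnn, hnx, hxn]
    ring
  have hAn : A n = 0 := by simp [hn, hAA]
  have hAm : A m = (k / 2) • n := by
    rw [hm, map_sub, map_smul, hAn, hn, smul_smul]
    field_simp
    simp
  refine ⟨(1 / 2 : ℝ) • (n + m), (1 / 2 : ℝ) • (n - m), k / 4, by simpa using hk,
    ?_, ?_, ?_, ?_, ?_, ?_⟩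
  · simp [hnn, hmm, hnm, hmn]; norm_num
  · simp [hnn, hmm, hnm, hmn]; norm_num
  · simp [hnn, hmm, hnm, hmn]
  · simp [hJself, hmJn, hnJm]
  · simp only [map_smul, map_add, hAn, hAm]; module
  · simp only [map_smul, map_sub, hAn, hAm]; module

end Hermitian

end ComplexStructure

/-- The real form of the Lie algebra `𝔲(1, 1)`. -/
theorem skew_commuting_matrix {X : Matrix (Fin 4) (Fin 4) ℝ}
    (hX : X.transpose * !![1,0,0,0; 0,1,0,0; 0,0,-1,0; 0,0,0,-1]
      = -(!![1,0,0,0; 0,1,0,0; 0,0,-1,0; 0,0,0,-1] * X))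
    (hXI : X * !![0,-1,0,0; 1,0,0,0; 0,0,0,-1; 0,0,1,0]
      = !![0,-1,0,0; 1,0,0,0; 0,0,0,-1; 0,0,1,0] * X) :
    ∃ b c d f : ℝ, X = !![0,-b,c,d; b,0,-d,c; c,-d,0,-f; d,c,f,0] := by
  have hX' := fun i j => congrFun (congrFun hX i) j
  have hXI' := fun i j => congrFun (congrFun hXI i) j
  simp [Fin.forall_fin_succ, Matrix.mul_apply, Matrix.vecMul, dotProduct, Fin.sum_univ_four]
    at hX' hXI'
  refine ⟨X 1 0, X 0 2, X 0 3, X 3 2, ?_⟩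
  ext i j
  fin_cases i <;> fin_cases j <;> simp <;> linarith

/-- The coefficients of the skew endomorphisms in an adapted basis. -/
theorem skew_pair_normalForm {X Y : Matrix (Fin 4) (Fin 4) ℝ} {a : ℝ} (ha : a ≠ 0)
    (hX : X.transpose * !![1,0,0,0; 0,1,0,0; 0,0,-1,0; 0,0,0,-1]
      = -(!![1,0,0,0; 0,1,0,0; 0,0,-1,0; 0,0,0,-1] * X))
    (hY : Y.transpose * !![1,0,0,0; 0,1,0,0; 0,0,-1,0; 0,0,0,-1]
      = -(!![1,0,0,0; 0,1,0,0; 0,0,-1,0; 0,0,0,-1] * Y))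
    (hXI : X * !![0,-1,0,0; 1,0,0,0; 0,0,0,-1; 0,0,1,0]
      = !![0,-1,0,0; 1,0,0,0; 0,0,0,-1; 0,0,1,0] * X)
    (hYI : Y * !![0,-1,0,0; 1,0,0,0; 0,0,0,-1; 0,0,1,0]
      = !![0,-1,0,0; 1,0,0,0; 0,0,0,-1; 0,0,1,0] * Y)
    (hc1 : !![a,0,-a,0; 0,-a,0,a; a,0,-a,0; 0,-a,0,a] * Y
        - Y * !![a,0,-a,0; 0,-a,0,a; a,0,-a,0; 0,-a,0,a]
      = !![0,-1,0,0; 1,0,0,0; 0,0,0,-1; 0,0,1,0] *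
        (!![a,0,-a,0; 0,-a,0,a; a,0,-a,0; 0,-a,0,a] * X
          - X * !![a,0,-a,0; 0,-a,0,a; a,0,-a,0; 0,-a,0,a]))
    (hc2 : X * Y = Y * X) :
    ∃ μ₁ μ₂ ν₁ ν₂ : ℝ, ν₁ * μ₂ = ν₂ * μ₁ ∧
      X = !![0, ν₂-μ₁, μ₂, μ₁; -ν₂+μ₁, 0, -μ₁, μ₂; μ₂, -μ₁, 0, ν₂+μ₁; μ₁, μ₂, -ν₂-μ₁, 0] ∧
      Y = !![0, -μ₂-ν₁, ν₂, ν₁; μ₂+ν₁, 0, -ν₁, ν₂; ν₂, -ν₁, 0, -μ₂+ν₁;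
        ν₁, ν₂, μ₂-ν₁, 0] := by
  obtain ⟨b, c, d, f, rfl⟩ := skew_commuting_matrix hX hXI
  obtain ⟨p, q, r, s, rfl⟩ := skew_commuting_matrix hY hYI
  have hc1' := fun i j => congrFun (congrFun hc1 i) j
  have hc2' := fun i j => congrFun (congrFun hc2 i) j
  simp [Fin.forall_fin_succ, Matrix.mul_apply, Fin.sum_univ_four] at hc1' hc2'
  have e1 : b = d - q := mul_left_cancel₀ ha (by linarith)
  have e2 : f = -d - q := mul_left_cancel₀ ha (by linarith)
  have e3 : p = c + r := mul_left_cancel₀ ha (by linarith)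
  have e4 : s = c - r := mul_left_cancel₀ ha (by linarith)
  subst e1 e2 e3 e4
  refine ⟨d, c, r, q, ?_, ?_, ?_⟩
  · linarith
  · ext i j
    fin_cases i <;> fin_cases j <;> simp <;> ring
  · ext i j
    fin_cases i <;> fin_cases j <;> simp <;> ring


/-- normal form for the data `(g, J, A, B₁, B₂)` on `ℝ⁴` when `A` is
not semisimple (Lemma `nonsemisimple`). -/
theorem stmt_9
    (g : (Fin 4 → ℝ) →ₗ[ℝ] (Fin 4 → ℝ) →ₗ[ℝ] ℝ)
    (gsymm : ∀ x y, g x y = g y x)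
    (gnd : ∀ x, (∀ y, g x y = 0) → x = 0)
    (J : Module.End ℝ (Fin 4 → ℝ))
    (hJ2 : J ∘ₗ J = -1)
    (hgJ : ∀ x y, g (J x) (J y) = g x y)
    (A B₁ B₂ : Module.End ℝ (Fin 4 → ℝ))
    -- A is g-symmetric and anticommutes with J
    (hAsym : ∀ x y, g (A x) y = g x (A y))
    (hAJ : A ∘ₗ J = -(J ∘ₗ A))
    -- B₁, B₂ are g-antisymmetric and commute with J
    (hB₁skew : ∀ x y, g (B₁ x) y = -(g x (B₁ y)))
    (hB₂skew : ∀ x y, g (B₂ x) y = -(g x (B₂ y)))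
    (hB₁J : B₁ ∘ₗ J = J ∘ₗ B₁)
    (hB₂J : B₂ ∘ₗ J = J ∘ₗ B₂)
    -- [A, B₂] = J ∘ [A, B₁] and [B₁, B₂] = 2 J ∘ A ∘ A
    (hc1 : A ∘ₗ B₂ - B₂ ∘ₗ A = J ∘ₗ (A ∘ₗ B₁ - B₁ ∘ₗ A))
    (hc2 : B₁ ∘ₗ B₂ - B₂ ∘ₗ B₁ = (2 : ℝ) • (J ∘ₗ A ∘ₗ A))
    -- A is not semisimple
    (hAss : ¬ A.IsSemisimple) :
    ∃ (e : Basis (Fin 4) ℝ (Fin 4 → ℝ)) (a μ₁ μ₂ ν₁ ν₂ : ℝ),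
      a ≠ 0
      ∧ (∃ c : ℝ, (ν₁, ν₂) = c • (μ₁, μ₂) ∨ (μ₁, μ₂) = c • (ν₁, ν₂))
      ∧ (∀ i j, g (e i) (e j) = !![(1:ℝ),0,0,0; 0,1,0,0; 0,0,-1,0; 0,0,0,-1] i j)
      ∧ J (e 0) = e 1 ∧ J (e 2) = e 3
      ∧ LinearMap.toMatrix e e A = !![a,0,-a,0; 0,-a,0,a; a,0,-a,0; 0,-a,0,a]
      ∧ LinearMap.toMatrix e e B₁ =
          !![0, ν₂-μ₁, μ₂, μ₁; -ν₂+μ₁, 0, -μ₁, μ₂; μ₂, -μ₁, 0, ν₂+μ₁; μ₁, μ₂, -ν₂-μ₁, 0]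
      ∧ LinearMap.toMatrix e e B₂ =
          !![0, -μ₂-ν₁, ν₂, ν₁; μ₂+ν₁, 0, -ν₁, ν₂; ν₂, -ν₁, 0, -μ₂+ν₁; ν₁, ν₂, μ₂-ν₁, 0] := by
  have hV : finrank ℝ (Fin 4 → ℝ) = 4 := by simp
  have hJ : ∀ x, J (J x) = -x := fun x => LinearMap.congr_fun hJ2 x
  have hAJ' : ∀ x, A (J x) = -J (A x) := fun x => LinearMap.congr_fun hAJ x
  have htr : LinearMap.trace ℝ (Fin 4 → ℝ) (A * A) = 0 := by
    have hJAA : J * (J * (A * A)) = -(A * A) := LinearMap.ext fun x => hJ (A (A x))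
    have hcomm : (2 : ℝ) • (J * (A * A)) = B₁ * B₂ - B₂ * B₁ := hc2.symm
    have hB₂J' : B₂ * J = J * B₂ := hB₂J
    have h2 : (2 : ℝ) • -(A * A) = J * B₁ * B₂ - B₂ * (J * B₁) := by
      rw [← hJAA, ← mul_smul_comm, hcomm, mul_sub, mul_assoc, ← mul_assoc J B₂,
        ← hB₂J', mul_assoc]
    have h3 := congrArg (LinearMap.trace ℝ (Fin 4 → ℝ)) h2
    rw [map_smul, map_neg, map_sub, LinearMap.trace_mul_comm ℝ (J * B₁) B₂, sub_self] at h3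
    simpa using h3
  have hAA := (isSemisimple_or_sq_eq_zero hV hJ hAJ' htr).resolve_left hAss
  have hA0 : A ≠ 0 := by
    rintro rfl
    exact hAss Module.End.isSemisimple_zero
  obtain ⟨u, v, a, ha, huu, hvv, huv, huJv, hAu, hAv⟩ :=
    exists_adapted_pair gsymm gnd hJ hgJ hAsym hAJ' hA0 hAA
  have hJskew := apply_complexStructure_left (g := g) hJ hgJ
  have hJself : ∀ y, g y (J y) = 0 := fun y => by linarith [hJskew y y, gsymm y (J y)]
  have hvu : g v u = 0 := by rw [gsymm, huv]
  have hvJu : g v (J u) = 0 := by rw [gsymm, hJskew, huJv, neg_zero]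
  have hu : u ≠ 0 := by
    rintro rfl
    simp at huu
  have hv : ∀ s t : ℝ, v ≠ s • u + t • J u := by
    intro s t h
    have := congrArg (g v) h
    simp [hvv, hvu, hvJu] at this
  obtain ⟨e, h0, h1, h2, h3⟩ := exists_basis_complexPlane hV hJ hu hv
  have hgram : ∀ i j, g (e i) (e j)
      = !![(1:ℝ),0,0,0; 0,1,0,0; 0,0,-1,0; 0,0,0,-1] i j := by
    intro i j
    fin_cases i <;> fin_cases j <;>
      simp [h0, h1, h2, h3, hgJ, hJskew, huu, hvv, huv, hvu, huJv, hvJu, hJself]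
  have hMA : LinearMap.toMatrix e e A = !![a,0,-a,0; 0,-a,0,a; a,0,-a,0; 0,-a,0,a] := by
    rw [← LinearMap.toMatrix_toLin e e !![a,0,-a,0; 0,-a,0,a; a,0,-a,0; 0,-a,0,a]]
    congr 1
    refine e.ext fun i => ?_
    rw [Matrix.toLin_self, Fin.sum_univ_four, h0, h1, h2, h3]
    fin_cases i <;> simp [h0, h1, h2, h3, hAJ', hAu, hAv] <;> module
  have hMJ : LinearMap.toMatrix e e J = !![0,-1,0,0; 1,0,0,0; 0,0,0,-1; 0,0,1,0] := by
    rw [← LinearMap.toMatrix_toLin e e !![0,-1,0,0; 1,0,0,0; 0,0,0,-1; 0,0,1,0]]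
    congr 1
    refine e.ext fun i => ?_
    rw [Matrix.toLin_self, Fin.sum_univ_four, h0, h1, h2, h3]
    fin_cases i <;> simp [h0, h1, h2, h3, hJ]
  have hskew : ∀ B : End ℝ (Fin 4 → ℝ), (∀ x y, g (B x) y = -(g x (B y))) →
      (LinearMap.toMatrix e e B).transpose * !![1,0,0,0; 0,1,0,0; 0,0,-1,0; 0,0,0,-1]
        = -(!![1,0,0,0; 0,1,0,0; 0,0,-1,0; 0,0,0,-1] * LinearMap.toMatrix e e B) := by
    intro B hB
    ext i j
    have hBe : ∀ k, B (e k) = ∑ l, LinearMap.toMatrix e e B l k • e l := fun k => by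
      rw [← Matrix.toLin_self e e, Matrix.toLin_toMatrix]
    have hij := hB (e i) (e j)
    rw [hBe i, hBe j] at hij
    simp only [map_sum, map_smul, LinearMap.sum_apply, LinearMap.smul_apply, hgram,
      smul_eq_mul] at hij
    simp only [Matrix.neg_apply, Matrix.mul_apply, Matrix.transpose_apply]
    rw [hij]
    simp only [mul_comm]
  have hmul : ∀ S T : End ℝ (Fin 4 → ℝ), LinearMap.toMatrix e e (S ∘ₗ T)
      = LinearMap.toMatrix e e S * LinearMap.toMatrix e e T := LinearMap.toMatrix_comp e e e
  have hB₁₂ : B₁ ∘ₗ B₂ = B₂ ∘ₗ B₁ := by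
    have hJAA : J ∘ₗ A ∘ₗ A = 0 := LinearMap.ext fun x => by simp [hAA]
    rwa [hJAA, smul_zero, sub_eq_zero] at hc2
  obtain ⟨μ₁, μ₂, ν₁, ν₂, hdep, hM₁, hM₂⟩ :=
    skew_pair_normalForm (X := LinearMap.toMatrix e e B₁) (Y := LinearMap.toMatrix e e B₂) ha
      (hskew B₁ hB₁skew) (hskew B₂ hB₂skew)
      (by rw [← hMJ, ← hmul, hB₁J, hmul]) (by rw [← hMJ, ← hmul, hB₂J, hmul])
      (by simp only [← hMA, ← hMJ, ← hmul, ← map_sub, hc1]) (by rw [← hmul, hB₁₂, hmul])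
  refine ⟨e, a, μ₁, μ₂, ν₁, ν₂, ha, ?_, hgram, by rw [h0, h1], by rw [h2, h3], hMA, hM₁, hM₂⟩
  by_cases hμ₁ : μ₁ = 0
  · by_cases hμ₂ : μ₂ = 0
    · exact ⟨0, Or.inr (by simp [hμ₁, hμ₂])⟩
    · refine ⟨ν₂ / μ₂, Or.inl (Prod.ext ?_ ?_)⟩ <;> simp <;> field_simp
      exact hdep
  · refine ⟨ν₁ / μ₁, Or.inl (Prod.ext ?_ ?_)⟩ <;> simp <;> field_simp
    exact hdep.symm
end

section
/- Let (𝔤, g, J_g) and (𝔥, h, J_h) be pseudo-Kähler Lie algebras and φ : 𝔥 → Der(𝔤) a Lie algebra homomorphism with J_g∘φ(A)^s = φ(J_h A)^s and J_g∘φ(A)^a = φ(A)^a∘J_g for all A ∈ 𝔥, and equip 𝔤̃ = 𝔤 ⋊_φ 𝔥 with the product structures (g̃, J̃). Let Ẽ : 𝔤̃ → 𝔤̃ be linear with block components E₁ : 𝔤 → 𝔤, E₂ : 𝔥 → 𝔤, E₃ : 𝔤 → 𝔥, E₄ : 𝔥 → 𝔥 (i.e. Ẽ(X+A) = (E₁X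 + E₂A) + (E₃X + E₄A)), and suppose Ẽ∘Ẽ = id, J̃∘Ẽ = -Ẽ∘J̃ and g̃(Ẽu, Ẽv) = -g̃(u, v) for all u, v ∈ 𝔤̃. Then Ẽ is parallel for the Levi-Civita connection of g̃, so that (𝔤̃, g̃, J̃, Ẽ) is a hypersymplectic Lie algebra, if and only if for all X, Y, Z ∈ 𝔤 and A, B, C ∈ 𝔥: (1) ∇ʰ_A(E₄B) = E₄(∇ʰ_A B); (2) φ(A)^a∘E₂ = E₂∘∇ʰ_A; (3) φ(A)^a∘E₁ = E₁∘φ(A)^a; (4) φ(B)^s(E₂C) = φ(C)^s(E₂B); (5) g(∇ᵍ_X Y, E₂C) = g((E₁∘φ(C)^s - φ(E₄C)^s)X, Y); (6) g(∇ᵍ_X(E₁Y) - E₁(∇ᵍ_X Y), Z) = g(φ(E₃Y)^s Z - φ(E₃Z)^s Y, X). Here ∇ᵍ and ∇ʰ are the Levi-Civita connections of (𝔤, g) and (𝔥, h). -/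
open Module

/-- A connection given by the Koszul formula is metric. -/
theorem koszul_skew {L : Type*} [LieRing L] [LieAlgebra ℝ L]
    {g : L →ₗ[ℝ] L →ₗ[ℝ] ℝ} (hs : ∀ x y, g x y = g y x) {lc : L →ₗ[ℝ] L →ₗ[ℝ] L}
    (hlc : ∀ x y z, 2 * g (lc x y) z = g ⁅x, y⁆ z - g y ⁅x, z⁆ - g x ⁅y, z⁆) (x y z : L) :
    g (lc x y) z = -g (lc x z) y := by
  have h₁ := hlc x y z
  have h₂ := hlc x z y
  rw [← lie_skew y z, map_neg] at h₁
  rw [hs y ⁅x, z⁆] at h₁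
  rw [hs z ⁅x, y⁆] at h₂
  linarith

/-- Two vectors pairing equally with everything under a nondegenerate form are equal. -/
theorem eq_of_forall_pairing_eq {L : Type*} [AddCommGroup L] [Module ℝ L]
    {g : L →ₗ[ℝ] L →ₗ[ℝ] ℝ} (hn : ∀ x, (∀ y, g x y = 0) → x = 0) {x y : L}
    (hxy : ∀ z, g x z = g y z) : x = y :=
  sub_eq_zero.1 <| hn _ fun z => by rw [map_sub, LinearMap.sub_apply, hxy, sub_self]

/-- The self-adjoint part of `f`, paired through the form. -/
theorem pairing_symmPart {L : Type*} [AddCommGroup L] [Module ℝ L]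
    {g : L →ₗ[ℝ] L →ₗ[ℝ] ℝ} (hs : ∀ x y, g x y = g y x) {f f' : Module.End ℝ L}
    (hf : ∀ x y, g (f x) y = g x (f' y)) (x y : L) :
    g (((2⁻¹ : ℝ) • (f + f')) x) y = 2⁻¹ * (g (f x) y + g (f y) x) := by
  simp [hs (f' x) y, hf y x, mul_add]

/-- The skew-adjoint part of `f`, paired through the form. -/
theorem pairing_skewPart {L : Type*} [AddCommGroup L] [Module ℝ L]
    {g : L →ₗ[ℝ] L →ₗ[ℝ] ℝ} (hs : ∀ x y, g x y = g y x) {f f' : Module.End ℝ L}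
    (hf : ∀ x y, g (f x) y = g x (f' y)) (x y : L) :
    g (((2⁻¹ : ℝ) • (f - f')) x) y = 2⁻¹ * (g (f x) y - g (f y) x) := by
  simp [hs (f' x) y, hf y x, mul_sub]

/-- characterization of when an almost hypersymplectic structure on a
pseudo-Kähler semidirect product `𝔤 ⋊_φ 𝔥` is parallel (Theorem `general_HS`). -/
theorem stmt_12
    (𝔤 𝔥 G : Type*)
    [LieRing 𝔤] [LieAlgebra ℝ 𝔤] [FiniteDimensional ℝ 𝔤]
    [LieRing 𝔥] [LieAlgebra ℝ 𝔥] [FiniteDimensional ℝ 𝔥]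
    [LieRing G] [LieAlgebra ℝ G] [FiniteDimensional ℝ G]
    (g : 𝔤 →ₗ[ℝ] 𝔤 →ₗ[ℝ] ℝ) (Jg : Module.End ℝ 𝔤)
    (h : 𝔥 →ₗ[ℝ] 𝔥 →ₗ[ℝ] ℝ) (Jh : Module.End ℝ 𝔥)
    (hpkg : IsPseudoKahler 𝔤 g Jg) (hpkh : IsPseudoKahler 𝔥 h Jh)
    -- φ : 𝔥 → Der(𝔤), a Lie algebra homomorphism into the derivations of 𝔤
    (φ : 𝔥 →ₗ[ℝ] Module.End ℝ 𝔤)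
    (hder : ∀ a x y, φ a ⁅x, y⁆ = ⁅φ a x, y⁆ + ⁅x, φ a y⁆)
    (hhom : ∀ a b, φ ⁅a, b⁆ = φ a ∘ₗ φ b - φ b ∘ₗ φ a)
    -- the g-adjoint on endomorphisms of 𝔤
    (adj : Module.End ℝ 𝔤 → Module.End ℝ 𝔤)
    (hadj : ∀ f x y, g (f x) y = g x (adj f y))
    -- φ defines a pseudo-Kähler extension
    (hext : ∀ a : 𝔥,
        Jg ∘ₗ ((2⁻¹ : ℝ) • (φ a + adj (φ a))) = (2⁻¹ : ℝ) • (φ (Jh a) + adj (φ (Jh a)))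
        ∧ Jg ∘ₗ ((2⁻¹ : ℝ) • (φ a - adj (φ a))) = ((2⁻¹ : ℝ) • (φ a - adj (φ a))) ∘ₗ Jg)
    -- G is the semidirect product 𝔤 ⋊_φ 𝔥, presented through i, p
    (i : 𝔤 →ₗ[ℝ] G) (p : 𝔥 →ₗ[ℝ] G)
    (hbij : Function.Bijective fun q : 𝔤 × 𝔥 => i q.1 + p q.2)
    (hbrk : ∀ x a y b, ⁅i x + p a, i y + p b⁆
      = i ⁅x, y⁆ + i (φ a y) - i (φ b x) + p ⁅a, b⁆)
    -- the product structures g̃ and J̃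
    (gt : G →ₗ[ℝ] G →ₗ[ℝ] ℝ)
    (hgt : ∀ x a y b, gt (i x + p a) (i y + p b) = g x y + h a b)
    (Jt : Module.End ℝ G)
    (hJt : ∀ x a, Jt (i x + p a) = i (Jg x) + p (Jh a))
    -- Levi-Civita connections of g, h, g̃
    (lcg : 𝔤 →ₗ[ℝ] 𝔤 →ₗ[ℝ] 𝔤)
    (hlcg : ∀ x y z, 2 * g (lcg x y) z = g ⁅x, y⁆ z - g y ⁅x, z⁆ - g x ⁅y, z⁆)
    (lch : 𝔥 →ₗ[ℝ] 𝔥 →ₗ[ℝ] 𝔥)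
    (hlch : ∀ a b c, 2 * h (lch a b) c = h ⁅a, b⁆ c - h b ⁅a, c⁆ - h a ⁅b, c⁆)
    (lct : G →ₗ[ℝ] G →ₗ[ℝ] G)
    (hlct : ∀ u v w, 2 * gt (lct u v) w = gt ⁅u, v⁆ w - gt v ⁅u, w⁆ - gt u ⁅v, w⁆)
    -- an almost hypersymplectic structure Ẽ with block components E₁, E₂, E₃, E₄
    (E1 : Module.End ℝ 𝔤) (E2 : 𝔥 →ₗ[ℝ] 𝔤) (E3 : 𝔤 →ₗ[ℝ] 𝔥) (E4 : Module.End ℝ 𝔥)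
    (Et : Module.End ℝ G)
    (hEt : ∀ x a, Et (i x + p a) = i (E1 x + E2 a) + p (E3 x + E4 a))
    (hE2 : Et ∘ₗ Et = 1)
    (hJE : Jt ∘ₗ Et = -(Et ∘ₗ Jt))
    (hgE : ∀ u v, gt (Et u) (Et v) = -(gt u v)) :
    (∀ u v, lct u (Et v) = Et (lct u v)) ↔
      ((∀ A B, lch A (E4 B) = E4 (lch A B))
      ∧ (∀ A : 𝔥, ((2⁻¹ : ℝ) • (φ A - adj (φ A))) ∘ₗ E2 = E2 ∘ₗ lch A)
      ∧ (∀ A : 𝔥, ((2⁻¹ : ℝ) • (φ A - adj (φ A))) ∘ₗ E1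
          = E1 ∘ₗ ((2⁻¹ : ℝ) • (φ A - adj (φ A))))
      ∧ (∀ B C : 𝔥, ((2⁻¹ : ℝ) • (φ B + adj (φ B))) (E2 C)
          = ((2⁻¹ : ℝ) • (φ C + adj (φ C))) (E2 B))
      ∧ (∀ X Y C, g (lcg X Y) (E2 C)
          = g ((E1 ∘ₗ ((2⁻¹ : ℝ) • (φ C + adj (φ C)))
              - (2⁻¹ : ℝ) • (φ (E4 C) + adj (φ (E4 C)))) X) Y)
      ∧ (∀ X Y Z, g (lcg X (E1 Y) - E1 (lcg X Y)) Z
          = g (((2⁻¹ : ℝ) • (φ (E3 Y) + adj (φ (E3 Y)))) Z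
              - ((2⁻¹ : ℝ) • (φ (E3 Z) + adj (φ (E3 Z)))) Y) X)) := by
  obtain ⟨gs, gn, -⟩ := hpkg
  obtain ⟨hs, hn, -⟩ := hpkh
  have surj : ∀ u : G, ∃ x a, u = i x + p a := fun u => by
    obtain ⟨q, hq⟩ := hbij.2 u
    exact ⟨q.1, q.2, hq.symm⟩
  have gtn : ∀ u, (∀ v, gt u v = 0) → u = 0 := by
    intro u hu
    obtain ⟨x, a, rfl⟩ := surj u
    have hx : x = 0 := gn x fun y => by simpa using (hgt x a y 0).symm.trans (hu _)
    have ha : a = 0 := hn a fun b => by simpa using (hgt x a 0 b).symm.trans (hu _)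
    simp [hx, ha]
  have lg := koszul_skew gs hlcg
  have lh := koszul_skew hs hlch
  have Eskew : ∀ u v, gt (Et u) v = -gt u (Et v) := fun u v => by
    have hv : Et (Et v) = v := LinearMap.congr_fun hE2 v
    rw [← hgE u (Et v), hv]
  have Eblock : ∀ x a y b, g (E1 x + E2 a) y + h (E3 x + E4 a) b
      = -(g x (E1 y + E2 b) + h a (E3 y + E4 b)) := fun x a y b => by
    rw [← hgt, ← hgt, ← hEt, ← hEt, Eskew]
  have e1 : ∀ x y, g (E1 x) y = -g x (E1 y) := fun x y => by simpa using Eblock x 0 y 0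
  have e2 : ∀ a x, g (E2 a) x = -h a (E3 x) := fun a x => by simpa using Eblock 0 a x 0
  have e4 : ∀ a b, h (E4 a) b = -h a (E4 b) := fun a b => by simpa using Eblock 0 a 0 b
  have lct_pairing : ∀ x a y b z c, gt (lct (i x + p a) (i y + p b)) (i z + p c)
      = g (lcg x y) z - 2⁻¹ * (g (φ b x) z + g (φ b z) x)
        + 2⁻¹ * (g (φ a y) z - g (φ a z) y)
        + 2⁻¹ * (g (φ c x) y + g (φ c y) x) + h (lch a b) c := by
    intro x a y b z c
    have hk := hlct (i x + p a) (i y + p b) (i z + p c)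
    generalize gt (lct (i x + p a) (i y + p b)) (i z + p c) = r at hk ⊢
    simp only [hbrk, ← map_add, ← map_sub, hgt] at hk
    simp only [map_add, map_sub, LinearMap.add_apply, LinearMap.sub_apply] at hk
    have h₁ := hlcg x y z
    have h₂ := hlch a b c
    rw [gs (φ b z) x, gs (φ a z) y, gs (φ c x) y, gs (φ c y) x]
    linarith
  have parallel_iff : (∀ u v, lct u (Et v) = Et (lct u v)) ↔ ∀ x a y b z c,
      gt (lct (i x + p a) (i (E1 y + E2 b) + p (E3 y + E4 b))) (i z + p c)
        + gt (lct (i x + p a) (i y + p b)) (i (E1 z + E2 c) + p (E3 z + E4 c)) = 0 := by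
    constructor
    · intro H x a y b z c
      rw [← hEt, ← hEt, H, Eskew, neg_add_cancel]
    · intro H u v
      refine eq_of_forall_pairing_eq gtn fun w => ?_
      obtain ⟨x, a, rfl⟩ := surj u
      obtain ⟨y, b, rfl⟩ := surj v
      obtain ⟨z, c, rfl⟩ := surj w
      have := H x a y b z c
      rw [← hEt, ← hEt] at this
      rw [Eskew]
      linarith
  rw [parallel_iff]
  simp only [lct_pairing]
  simp only [map_add, LinearMap.add_apply]
  constructor
  · intro H
    refine ⟨fun A B => ?_, fun A => ?_, fun A => ?_, fun B C => ?_, fun X Y C => ?_,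
      fun X Y Z => ?_⟩
    · refine eq_of_forall_pairing_eq hn fun c => ?_
      have := H 0 A 0 B 0 c
      simp only [map_zero, LinearMap.zero_apply] at this
      rw [e4]
      linarith
    · refine LinearMap.ext fun b => eq_of_forall_pairing_eq gn fun z => ?_
      have := H 0 A 0 b z 0
      simp only [map_zero, LinearMap.zero_apply] at this
      rw [LinearMap.comp_apply, LinearMap.comp_apply, pairing_skewPart gs (hadj _), e2]
      linarith
    · refine LinearMap.ext fun y => eq_of_forall_pairing_eq gn fun z => ?_
      have := H 0 A y 0 z 0
      simp only [map_zero, LinearMap.zero_apply] at this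
      rw [LinearMap.comp_apply, LinearMap.comp_apply, e1, pairing_skewPart gs (hadj _),
        pairing_skewPart gs (hadj _)]
      linarith
    · refine eq_of_forall_pairing_eq gn fun x => ?_
      have := H x 0 0 B 0 C
      simp only [map_zero, LinearMap.zero_apply] at this
      rw [pairing_symmPart gs (hadj _), pairing_symmPart gs (hadj _)]
      linarith
    · have := H X 0 Y 0 0 C
      simp only [map_zero, LinearMap.zero_apply] at this
      rw [LinearMap.sub_apply, LinearMap.comp_apply, map_sub, LinearMap.sub_apply, e1,
        pairing_symmPart gs (hadj _), pairing_symmPart gs (hadj _)]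
      linarith
    · have := H X 0 Y 0 Z 0
      simp only [map_zero, LinearMap.zero_apply] at this
      rw [map_sub, LinearMap.sub_apply, map_sub, LinearMap.sub_apply, e1,
        pairing_symmPart gs (hadj _), pairing_symmPart gs (hadj _)]
      linarith
  · rintro ⟨c1, c2, c3, c4, c5, c6⟩ x a y b z c
    have k1 := congrArg (fun v => h v c) (c1 a b)
    have k2 : ∀ b z, _ := fun b z => congrArg (fun v => g v z) (LinearMap.congr_fun (c2 a) b)
    have k3 := congrArg (fun v => g v z) (LinearMap.congr_fun (c3 a) y)
    have k4 := congrArg (fun v => g v x) (c4 b c)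
    have k5 := c5 x y c
    have k5' := c5 x z b
    have k6 := c6 x y z
    simp only [LinearMap.comp_apply, LinearMap.sub_apply, map_sub, e1, e2, e4,
      pairing_symmPart gs (hadj _), pairing_skewPart gs (hadj _)] at k1 k2 k3 k4 k5 k5' k6
    have k2₁ := k2 b z
    have k2₂ := k2 c y
    have l₁ := lg x (E2 b) z
    have l₂ := lh a (E3 y) c
    linarith
end

section
/- Let 𝔤 and 𝔥 be abelian finite-dimensional real Lie algebras carrying hypersymplectic structures (g, J_g, E_g) and (h, J_h, E_h) respectively, and let φ : 𝔥 → End(𝔤) be a linear map such that each φ(A) is g-antisymmetric, commutes with J_g and with E_g, and the endomorphisms φ(A) (A ∈ 𝔥) pairwise commute (so φ is a Lie algebra homomorphism into Der(𝔤) = End(𝔤)). Then 𝔤̃ = 𝔤 ⋊_φ 𝔥 with the product structures g̃, J̃ and Ẽ(X+A) = E_g X + E_h A is a hypersymplectic Lie algebra, and g̃ is flat: the curvature R̃(u,v)w = ∇̃_u ∇̃_v w - ∇̃_v ∇̃_u w - ∇̃_{[u,v]} w of the Levi-Civita connection ∇̃ of g̃ vanishes for all u, v, w ∈ 𝔤̃.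 -/
open Module

/-- A hypersymplectic Lie algebra structure: a pseudo-Kähler structure `(g, J)`
together with a compatible parallel almost para-complex structure `E`. -/
def IsHypersymplectic (L : Type*) [LieRing L] [LieAlgebra ℝ L] [FiniteDimensional ℝ L]
    (g : L →ₗ[ℝ] L →ₗ[ℝ] ℝ) (J E : Module.End ℝ L) : Prop :=
  IsPseudoKahler L g J ∧
  (E ∘ₗ E = 1) ∧
  (J ∘ₗ E = -(E ∘ₗ J)) ∧
  (∀ x y, g (E x) (E y) = -(g x y)) ∧
  ∀ lc : L →ₗ[ℝ] L →ₗ[ℝ] L,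
    (∀ x y z, 2 * g (lc x y) z = g ⁅x, y⁆ z - g y ⁅x, z⁆ - g x ⁅y, z⁆) →
    ∀ x y, lc x (E y) = E (lc x y)

/-- The Levi-Civita connection of a semidirect product `𝔤 ⋊_φ 𝔥` of abelian metric Lie algebras,
with `φ` acting by skew endomorphisms, is `∇_{x + a} (y + b) = φ a y`. -/
theorem leviCivita_semidirect {𝔤 𝔥 G : Type*}
    [LieRing 𝔤] [LieAlgebra ℝ 𝔤] [LieRing 𝔥] [LieAlgebra ℝ 𝔥] [LieRing G] [LieAlgebra ℝ G]
    {g : 𝔤 →ₗ[ℝ] 𝔤 →ₗ[ℝ] ℝ} {h : 𝔥 →ₗ[ℝ] 𝔥 →ₗ[ℝ] ℝ} {φ : 𝔥 →ₗ[ℝ] Module.End ℝ 𝔤}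
    (hsymm : ∀ x y, g x y = g y x) (hskew : ∀ a x y, g (φ a x) y = -(g x (φ a y)))
    {i : 𝔤 →ₗ[ℝ] G} {p : 𝔥 →ₗ[ℝ] G} (hsurj : ∀ u, ∃ x a, i x + p a = u)
    (hbrk : ∀ x a y b, ⁅i x + p a, i y + p b⁆ = i (φ a y - φ b x) + p 0)
    {gt : G →ₗ[ℝ] G →ₗ[ℝ] ℝ}
    (hgt : ∀ x a y b, gt (i x + p a) (i y + p b) = g x y + h a b)
    (hnd : ∀ u, (∀ v, gt u v = 0) → u = 0)
    {lc : G →ₗ[ℝ] G →ₗ[ℝ] G}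
    (hlc : ∀ u v w, 2 * gt (lc u v) w = gt ⁅u, v⁆ w - gt v ⁅u, w⁆ - gt u ⁅v, w⁆)
    (x : 𝔤) (a : 𝔥) (y : 𝔤) (b : 𝔥) :
    lc (i x + p a) (i y + p b) = i (φ a y) + p 0 := by
  refine sub_eq_zero.mp (hnd _ fun w ↦ ?_)
  obtain ⟨z, c, rfl⟩ := hsurj w
  have key := hlc (i x + p a) (i y + p b) (i z + p c)
  rw [hbrk, hbrk, hbrk, hgt, hgt, hgt] at key
  rw [map_sub, LinearMap.sub_apply, hgt]
  simp only [map_sub, map_zero, LinearMap.sub_apply, LinearMap.zero_apply] at key ⊢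
  linarith [hskew a y z, hskew b x z, hskew c x y, hsymm y (φ c x)]

/-- a semidirect product of abelian hypersymplectic Lie algebras along a
representation by antisymmetric endomorphisms commuting with `J_g` and `E_g` (and with
each other) is hypersymplectic and flat. -/
theorem stmt_15
    (𝔤 𝔥 G : Type*)
    [LieRing 𝔤] [LieAlgebra ℝ 𝔤] [FiniteDimensional ℝ 𝔤]
    [LieRing 𝔥] [LieAlgebra ℝ 𝔥] [FiniteDimensional ℝ 𝔥]
    [LieRing G] [LieAlgebra ℝ G] [FiniteDimensional ℝ G]
    (hgab : ∀ x y : 𝔤, ⁅x, y⁆ = 0)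
    (hhab : ∀ a b : 𝔥, ⁅a, b⁆ = 0)
    (g : 𝔤 →ₗ[ℝ] 𝔤 →ₗ[ℝ] ℝ) (Jg Eg : Module.End ℝ 𝔤)
    (h : 𝔥 →ₗ[ℝ] 𝔥 →ₗ[ℝ] ℝ) (Jh Eh : Module.End ℝ 𝔥)
    (hhsg : IsHypersymplectic 𝔤 g Jg Eg) (hhsh : IsHypersymplectic 𝔥 h Jh Eh)
    -- φ with g-antisymmetric values commuting with J_g, E_g and with each other
    (φ : 𝔥 →ₗ[ℝ] Module.End ℝ 𝔤)
    (hskew : ∀ a x y, g (φ a x) y = -(g x (φ a y)))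
    (hφJ : ∀ a, φ a ∘ₗ Jg = Jg ∘ₗ φ a)
    (hφE : ∀ a, φ a ∘ₗ Eg = Eg ∘ₗ φ a)
    (hcomm : ∀ a b, φ a ∘ₗ φ b = φ b ∘ₗ φ a)
    -- G is the semidirect product 𝔤 ⋊_φ 𝔥, presented through i, p
    (i : 𝔤 →ₗ[ℝ] G) (p : 𝔥 →ₗ[ℝ] G)
    (hbij : Function.Bijective fun q : 𝔤 × 𝔥 => i q.1 + p q.2)
    (hbrk : ∀ x a y b, ⁅i x + p a, i y + p b⁆
      = i ⁅x, y⁆ + i (φ a y) - i (φ b x) + p ⁅a, b⁆)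
    -- the product structures
    (gt : G →ₗ[ℝ] G →ₗ[ℝ] ℝ)
    (hgt : ∀ x a y b, gt (i x + p a) (i y + p b) = g x y + h a b)
    (Jt : Module.End ℝ G)
    (hJt : ∀ x a, Jt (i x + p a) = i (Jg x) + p (Jh a))
    (Et : Module.End ℝ G)
    (hEt : ∀ x a, Et (i x + p a) = i (Eg x) + p (Eh a)) :
    IsHypersymplectic G gt Jt Et
    ∧ ∀ lct : G →ₗ[ℝ] G →ₗ[ℝ] G,
        (∀ u v w, 2 * gt (lct u v) w = gt ⁅u, v⁆ w - gt v ⁅u, w⁆ - gt u ⁅v, w⁆) →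
        ∀ u v w : G, lct u (lct v w) - lct v (lct u w) - lct ⁅u, v⁆ w = 0 := by
  obtain ⟨⟨gsymm, gnd, gJJ, gJ, -⟩, gEE, gJE, gE, -⟩ := hhsg
  obtain ⟨⟨hsymm, hnd, hJJ, hJ, -⟩, hEE, hJE, hE, -⟩ := hhsh
  have hsurj : ∀ u, ∃ x a, i x + p a = u := fun u ↦
    let ⟨q, hq⟩ := hbij.2 u
    ⟨q.1, q.2, hq⟩
  have hbrk' : ∀ x a y b, ⁅i x + p a, i y + p b⁆ = i (φ a y - φ b x) + p 0 := fun x a y b ↦ by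
    rw [hbrk, hgab, hhab, map_zero, zero_add, map_sub]
  have gtnd : ∀ u, (∀ v, gt u v = 0) → u = 0 := fun u hu ↦ by
    obtain ⟨x, a, rfl⟩ := hsurj u
    have hx : x = 0 := gnd x fun y ↦ by
      rw [← hu (i y + p 0), hgt, map_zero, add_zero]
    have ha : a = 0 := hnd a fun b ↦ by
      rw [← hu (i 0 + p b), hgt, map_zero, zero_add]
    simp [hx, ha]
  refine ⟨⟨⟨?_, gtnd, ?_, ?_, ?_⟩, ?_, ?_, ?_, ?_⟩, ?_⟩
  · intro u v
    obtain ⟨x, a, rfl⟩ := hsurj u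
    obtain ⟨y, b, rfl⟩ := hsurj v
    rw [hgt, hgt, gsymm, hsymm]
  · ext u
    obtain ⟨x, a, rfl⟩ := hsurj u
    have h₁ : Jg (Jg x) = -x := LinearMap.congr_fun gJJ x
    have h₂ : Jh (Jh a) = -a := LinearMap.congr_fun hJJ a
    simp only [LinearMap.comp_apply, hJt, h₁, h₂, map_neg, LinearMap.neg_apply, End.one_apply]
    abel
  · intro u v
    obtain ⟨x, a, rfl⟩ := hsurj u
    obtain ⟨y, b, rfl⟩ := hsurj v
    rw [hJt, hJt, hgt, hgt, gJ, hJ]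
  · intro lc hlc u v
    obtain ⟨x, a, rfl⟩ := hsurj u
    obtain ⟨y, b, rfl⟩ := hsurj v
    have h₁ : φ a (Jg y) = Jg (φ a y) := LinearMap.congr_fun (hφJ a) y
    have nabla := leviCivita_semidirect gsymm hskew hsurj hbrk' hgt gtnd hlc
    rw [hJt, nabla, nabla, hJt, h₁, map_zero Jh]
  · ext u
    obtain ⟨x, a, rfl⟩ := hsurj u
    have h₁ : Eg (Eg x) = x := LinearMap.congr_fun gEE x
    have h₂ : Eh (Eh a) = a := LinearMap.congr_fun hEE a
    simp only [LinearMap.comp_apply, hEt, h₁, h₂, End.one_apply]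
  · ext u
    obtain ⟨x, a, rfl⟩ := hsurj u
    have h₁ : Jg (Eg x) = -Eg (Jg x) := LinearMap.congr_fun gJE x
    have h₂ : Jh (Eh a) = -Eh (Jh a) := LinearMap.congr_fun hJE a
    simp only [LinearMap.comp_apply, LinearMap.neg_apply, hJt, hEt, h₁, h₂, map_neg]
    abel
  · intro u v
    obtain ⟨x, a, rfl⟩ := hsurj u
    obtain ⟨y, b, rfl⟩ := hsurj v
    rw [hEt, hEt, hgt, hgt, gE, hE, neg_add]
  · intro lc hlc u v
    obtain ⟨x, a, rfl⟩ := hsurj u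
    obtain ⟨y, b, rfl⟩ := hsurj v
    have h₁ : φ a (Eg y) = Eg (φ a y) := LinearMap.congr_fun (hφE a) y
    have nabla := leviCivita_semidirect gsymm hskew hsurj hbrk' hgt gtnd hlc
    rw [hEt, nabla, nabla, hEt, h₁, map_zero Eh]
  · intro lc hlc u v w
    obtain ⟨x, a, rfl⟩ := hsurj u
    obtain ⟨y, b, rfl⟩ := hsurj v
    obtain ⟨z, c, rfl⟩ := hsurj w
    have h₁ : φ a (φ b z) = φ b (φ a z) := LinearMap.congr_fun (hcomm a b) z
    have nabla := leviCivita_semidirect gsymm hskew hsurj hbrk' hgt gtnd hlc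
    rw [hbrk', nabla, nabla, nabla, nabla, nabla, h₁, sub_self, map_zero φ]
    simp only [LinearMap.zero_apply, map_zero, add_zero, sub_zero]
end
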